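/- Let A = (Q,T) be a strongly connected d-dimensional VASS satisfying condition (C), let n be a good normal for A, and let A^n = (Q, T_n) where T_n = {t ∈ T : there is a short cycle γ of A containing t with eff(γ) · n = 0}. Let C_1,…,C_k (k ≥ 1) be all strongly connected components of A^n containing at least one transition. If every restricted VASS A^n_{C_i} is terminating with termination complexity Θ(f_i(n)), then A is terminating and 𝓛_A(n) ∈ Θ(n · max{f_1(n),…,f_k(n)}). -/

import Mathlib

open scoped BigOperators ENNReal

/-- A `d`-dimensional VASS: a set of states `Q` together with transitions
labelled by vectors in `{-1,0,1}^d`. -/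
structure VASS (d : ℕ) (Q : Type) where
  T : Set (Q × (Fin d → ℤ) × Q)
  upd_mem : ∀ t ∈ T, ∀ i, t.2.1 i = -1 ∨ t.2.1 i = 0 ∨ t.2.1 i = 1

namespace VASS

variable {d : ℕ} {Q : Type}

/-- Scalar product of an integer vector with a real vector. -/
def dotZ (v : Fin d → ℤ) (w : Fin d → ℝ) : ℝ := ∑ i, (v i : ℝ) * w i

/-- Scalar product of two real vectors. -/
def dotR (v w : Fin d → ℝ) : ℝ := ∑ i, v i * w i

/-- `A.IsPath n p u` : `p 0, u 0, p 1, u 1, …, u (n-1), p n` is a finite path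
of length `n ≥ 1` in `A`. -/
def IsPath (A : VASS d Q) (n : ℕ) (p : ℕ → Q) (u : ℕ → Fin d → ℤ) : Prop :=
  1 ≤ n ∧ ∀ i < n, (p i, u i, p (i + 1)) ∈ A.T

/-- Effect of a path of length `n` with update vectors `u`. -/
def eff (n : ℕ) (u : ℕ → Fin d → ℤ) : Fin d → ℤ :=
  fun i => ∑ j ∈ Finset.range n, u j i

/-- A short cycle: a cycle of length at most `|Q|`. -/
def IsShortCycle (A : VASS d Q) (n : ℕ) (p : ℕ → Q) (u : ℕ → Fin d → ℤ) : Prop :=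
  A.IsPath n p u ∧ p n = p 0 ∧ n ≤ Nat.card Q

/-- `Inc A` : the set of effects of short cycles of `A`. -/
def Inc (A : VASS d Q) : Set (Fin d → ℤ) :=
  { v | ∃ n p u, A.IsShortCycle n p u ∧ v = eff n u }

/-- A zero-avoiding computation of length `n` : all configurations have all
counters positive and consecutive configurations are related by transitions. -/
def IsZeroAvoiding (A : VASS d Q) (n : ℕ) (q : ℕ → Q) (z : ℕ → Fin d → ℕ) : Prop :=
  (∀ i ≤ n, ∀ j, 0 < z i j) ∧
  ∀ i < n, (q i, fun j => (z (i + 1) j : ℤ) - (z i j : ℤ), q (i + 1)) ∈ A.T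

/-- `L(pv)` : the least bound on the length of zero-avoiding computations
initiated in the configuration `p v`. -/
noncomputable def Lval (A : VASS d Q) (p : Q) (v : Fin d → ℕ) : ℕ∞ :=
  ⨆ (n : ℕ) (_ : ∃ q z, q 0 = p ∧ z 0 = v ∧ A.IsZeroAvoiding n q z), (n : ℕ∞)

/-- Termination complexity `𝓛(n)` : the max of `L(pv)` over configurations of size `n`. -/
noncomputable def L (A : VASS d Q) (n : ℕ) : ℕ∞ :=
  ⨆ (p : Q) (v : Fin d → ℕ) (_ : Finset.univ.sup v = n), A.Lval p v

/-- The set of normals of `A`: nonzero vectors `nv` with `v · nv ≤ 0` for all `v ∈ Inc A`. -/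
def Normals (A : VASS d Q) : Set (Fin d → ℝ) :=
  { nv | nv ≠ 0 ∧ ∀ v ∈ A.Inc, dotZ v nv ≤ 0 }

/-- The cone (over ℝ) generated by a set of integer vectors. -/
def coneZ (V : Set (Fin d → ℤ)) : Set (Fin d → ℝ) :=
  { x | ∃ (k : ℕ) (a : Fin k → ℝ) (v : Fin k → Fin d → ℤ),
      (∀ j, 0 ≤ a j) ∧ (∀ j, v j ∈ V) ∧ x = ∑ j, a j • (fun i => ((v j i : ℝ))) }

/-- A good normal: a positive normal such that for every `v ∈ cone(Inc A)`,
`-v ∈ cone(Inc A)` iff `v · n = 0`. -/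
def IsGoodNormal (A : VASS d Q) (nv : Fin d → ℝ) : Prop :=
  nv ∈ A.Normals ∧ (∀ i, 0 < nv i) ∧
  ∀ x ∈ coneZ A.Inc, (-x ∈ coneZ A.Inc ↔ dotR x nv = 0)

/-- `A.Reaches p q` : there is a finite path from `p` to `q`. -/
def Reaches (A : VASS d Q) (p q : Q) : Prop :=
  ∃ n pp u, A.IsPath n pp u ∧ pp 0 = p ∧ pp n = q

/-- A strongly connected component: a maximal set of states pairwise connected
by finite paths. -/
def IsSCC (A : VASS d Q) (R : Set Q) : Prop :=
  (∀ p ∈ R, ∀ q ∈ R, p ≠ q → A.Reaches p q) ∧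
  ∀ S : Set Q, R ⊆ S → (∀ p ∈ S, ∀ q ∈ S, p ≠ q → A.Reaches p q) → S = R

/-- The VASS `A` restricted to the states of `R` and transitions within `R`. -/
def restrict (A : VASS d Q) (R : Set Q) : VASS d R where
  T := { t | ((t.1 : Q), t.2.1, (t.2.2 : Q)) ∈ A.T }
  upd_mem := fun _ ht i => A.upd_mem _ ht i

/-- The VASS `A^nv = (Q, T_nv)` where `T_nv` consists of the transitions of `A`
contained in some short cycle `γ` with `eff(γ) · nv = 0`. -/
def neutral (A : VASS d Q) (nv : Fin d → ℝ) : VASS d Q where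
  T := { t ∈ A.T | ∃ n p u, A.IsShortCycle n p u ∧ dotZ (eff n u) nv = 0 ∧
          ∃ i < n, (p i, u i, p (i + 1)) = t }
  upd_mem := fun t ht i => A.upd_mem t ht.1 i

end VASS

namespace VASS

section LinearAlgebra

/-- Farkas' lemma for finitely many functionals on an arbitrary real vector space. -/
theorem farkas {ι E : Type*} [AddCommGroup E] [Module ℝ E] (I : Finset ι) :
    ∀ (a : ι → E →ₗ[ℝ] ℝ) (g : E →ₗ[ℝ] ℝ),
      (∀ x, (∀ i ∈ I, a i x ≤ 0) → g x ≤ 0) →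
      ∃ c : ι → ℝ, (∀ i, 0 ≤ c i) ∧ g = ∑ i ∈ I, c i • a i := by
  classical
  induction I using Finset.induction_on with
  | empty =>
    intro a g h
    refine ⟨fun _ => 0, fun _ => le_rfl, ?_⟩
    ext x
    have h1 := h x (by simp)
    have h2 := h (-x) (by simp)
    simp only [map_neg] at h2
    simp only [Finset.sum_empty, LinearMap.zero_apply]
    linarith
  | insert m I hm ih =>
    intro a g h
    by_cases hI : ∀ x, (∀ i ∈ I, a i x ≤ 0) → g x ≤ 0
    · obtain ⟨c, hc, hg⟩ := ih a g hI
      refine ⟨fun i => if i = m then 0 else c i, fun i => ?_, ?_⟩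
      · dsimp only
        split_ifs
        exacts [le_rfl, hc i]
      · rw [Finset.sum_insert hm, hg]
        simp only [if_true, zero_smul, zero_add]
        refine Finset.sum_congr rfl fun i hi => ?_
        rw [if_neg (ne_of_mem_of_not_mem hi hm)]
    · push Not at hI
      obtain ⟨y, hy, hgy⟩ := hI
      have hmy : 0 < a m y := by
        by_contra hcon
        refine absurd (h y fun i hi => ?_) (not_le.2 hgy)
        rcases Finset.mem_insert.1 hi with rfl | hi
        exacts [not_lt.1 hcon, hy i hi]
      set z := (a m y)⁻¹ • y with hz
      have hmz : a m z = 1 := by simp [hz, hmy.ne']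
      have hiz : ∀ i ∈ I, a i z ≤ 0 := fun i hi => by
        simpa [hz] using mul_nonpos_of_nonneg_of_nonpos (inv_nonneg.2 hmy.le) (hy i hi)
      have hgz : 0 < g z := by simpa [hz] using mul_pos (inv_pos.2 hmy) hgy
      obtain ⟨c, hc, hg⟩ := ih (fun i => a i - a i z • a m) (g - g z • a m) (by
        intro x hx
        have := h (x - a m x • z) (by
          intro i hi
          rcases Finset.mem_insert.1 hi with rfl | hi
          · simp [hmz]
          · have := hx i hi
            simp only [LinearMap.sub_apply, LinearMap.smul_apply, smul_eq_mul, map_sub,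
              map_smul] at this ⊢
            linarith)
        simp only [LinearMap.sub_apply, LinearMap.smul_apply, smul_eq_mul, map_sub,
              map_smul] at this ⊢
        linarith)
      refine ⟨fun i => if i = m then g z - ∑ i ∈ I, c i * a i z else c i, fun i => ?_, ?_⟩
      · dsimp only
        split_ifs
        · have : ∑ i ∈ I, c i * a i z ≤ 0 :=
            Finset.sum_nonpos fun i hi => mul_nonpos_of_nonneg_of_nonpos (hc i) (hiz i hi)
          linarith
        · exact hc i
      · rw [Finset.sum_insert hm]
        have hs : ∑ i ∈ I, (if i = m then g z - ∑ i ∈ I, c i * a i z else c i) • a i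
            = ∑ i ∈ I, c i • a i :=
          Finset.sum_congr rfl fun i hi => by
            rw [if_neg (ne_of_mem_of_not_mem hi hm)]
        rw [hs]
        simp only [if_true]
        ext x
        have hx := LinearMap.congr_fun hg x
        simp only [LinearMap.sub_apply, LinearMap.smul_apply, smul_eq_mul, LinearMap.sum_apply,
          LinearMap.add_apply, mul_sub, Finset.sum_sub_distrib] at hx ⊢
        have : ∑ i ∈ I, c i * (a i z * a m x) = (∑ i ∈ I, c i * a i z) * a m x := by
          rw [Finset.sum_mul]
          exact Finset.sum_congr rfl fun i _ => by ring
        rw [this] at hx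
        linarith

variable {d : ℕ}

/-- The real vector with the given integer coordinates. -/
def toReal (v : Fin d → ℤ) : Fin d → ℝ := fun i => (v i : ℝ)

theorem toReal_add (v w : Fin d → ℤ) : toReal (v + w) = toReal v + toReal w := by
  ext i
  simp [toReal]

theorem dotR_toReal (v : Fin d → ℤ) (w : Fin d → ℝ) : dotR (toReal v) w = dotZ v w := rfl

theorem dotZ_add (v v' : Fin d → ℤ) (w : Fin d → ℝ) :
    dotZ (v + v') w = dotZ v w + dotZ v' w := by
  simp [dotZ, add_mul, Finset.sum_add_distrib]

theorem dotR_add_right (v w w' : Fin d → ℝ) : dotR v (w + w') = dotR v w + dotR v w' := by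
  simp [dotR, mul_add, Finset.sum_add_distrib]

theorem dotR_smul_right (v w : Fin d → ℝ) (c : ℝ) : dotR v (c • w) = c * dotR v w := by
  simp only [dotR, Pi.smul_apply, smul_eq_mul, Finset.mul_sum]
  exact Finset.sum_congr rfl fun i _ => by ring

theorem dotR_sum_right {ι : Type*} (s : Finset ι) (v : Fin d → ℝ) (w : ι → Fin d → ℝ) :
    dotR v (∑ i ∈ s, w i) = ∑ i ∈ s, dotR v (w i) := by
  simp only [dotR, Finset.sum_apply, Finset.mul_sum]
  exact Finset.sum_comm

theorem dotR_neg_left (v w : Fin d → ℝ) : dotR (-v) w = -dotR v w := by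
  simp [dotR]

/-- The functional `x ↦ v · x`. -/
def dotLin (v : Fin d → ℝ) : (Fin d → ℝ) →ₗ[ℝ] ℝ where
  toFun := dotR v
  map_add' := dotR_add_right v
  map_smul' c w := dotR_smul_right v w c

/-- The cone generated by a finite set of integer vectors. -/
def finCone (I : Finset (Fin d → ℤ)) : Set (Fin d → ℝ) :=
  { x | ∃ a : (Fin d → ℤ) → ℝ, (∀ v, 0 ≤ a v) ∧ x = ∑ v ∈ I, a v • toReal v }

theorem zero_mem_finCone (I : Finset (Fin d → ℤ)) : (0 : Fin d → ℝ) ∈ finCone I :=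
  ⟨0, fun _ => le_rfl, by simp⟩

theorem add_mem_finCone {I : Finset (Fin d → ℤ)} {x y : Fin d → ℝ} (hx : x ∈ finCone I)
    (hy : y ∈ finCone I) : x + y ∈ finCone I := by
  obtain ⟨a, ha, rfl⟩ := hx
  obtain ⟨b, hb, rfl⟩ := hy
  refine ⟨a + b, fun v => add_nonneg (ha v) (hb v), ?_⟩
  simp [add_smul, Finset.sum_add_distrib]

theorem smul_mem_finCone {I : Finset (Fin d → ℤ)} {x : Fin d → ℝ} (hx : x ∈ finCone I)
    {c : ℝ} (hc : 0 ≤ c) : c • x ∈ finCone I := by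
  obtain ⟨a, ha, rfl⟩ := hx
  refine ⟨fun v => c * a v, fun v => mul_nonneg hc (ha v), ?_⟩
  simp [mul_smul, Finset.smul_sum]

theorem sum_mem_finCone {ι : Type*} {I : Finset (Fin d → ℤ)} (s : Finset ι)
    {x : ι → Fin d → ℝ} (hx : ∀ i ∈ s, x i ∈ finCone I) : ∑ i ∈ s, x i ∈ finCone I := by
  classical
  induction s using Finset.induction_on with
  | empty => simpa using zero_mem_finCone I
  | insert m s hm ih =>
    rw [Finset.sum_insert hm]
    exact add_mem_finCone (hx _ (Finset.mem_insert_self _ _))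
      (ih fun i hi => hx i (Finset.mem_insert_of_mem hi))

theorem toReal_mem_finCone {I : Finset (Fin d → ℤ)} {v : Fin d → ℤ} (hv : v ∈ I) :
    toReal v ∈ finCone I := by
  classical
  refine ⟨fun w => if w = v then 1 else 0, fun w => ?_, ?_⟩
  · dsimp only
    split_ifs <;> norm_num
  · simp [hv]

theorem coneZ_eq_finCone (I : Finset (Fin d → ℤ)) : coneZ (I : Set (Fin d → ℤ)) = finCone I := by
  ext x
  constructor
  · rintro ⟨k, a, v, ha, hv, rfl⟩
    exact sum_mem_finCone _ fun j _ =>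
      smul_mem_finCone (toReal_mem_finCone (Finset.mem_coe.1 (hv j))) (ha j)
  · rintro ⟨a, ha, rfl⟩
    refine ⟨I.card, fun j => a (I.equivFin.symm j), fun j => I.equivFin.symm j,
      fun j => ha _, fun j => (I.equivFin.symm j).2, ?_⟩
    rw [← Finset.sum_coe_sort, ← Equiv.sum_comp I.equivFin.symm]
    rfl

/-- A separating normal for a vector outside a finitely generated cone. -/
theorem exists_separating {I : Finset (Fin d → ℤ)} {x : Fin d → ℝ} (hx : x ∉ finCone I) :
    ∃ m : Fin d → ℝ, (∀ v ∈ I, dotZ v m ≤ 0) ∧ 0 < dotR x m := by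
  by_contra hcon
  push Not at hcon
  obtain ⟨c, hc, hg⟩ := farkas I (fun v => dotLin (toReal v)) (dotLin x) hcon
  refine hx ⟨c, hc, ?_⟩
  ext j
  have := LinearMap.congr_fun hg (Pi.single j 1)
  simpa [dotLin, dotR, Pi.single_apply] using this

/-- A subspace contained in a finitely generated cone is covered with coefficients bounded
linearly in the size of the vector. -/
theorem exists_bounded_coeff {I : Finset (Fin d → ℤ)} (V : Submodule ℝ (Fin d → ℝ))
    (hV : (V : Set (Fin d → ℝ)) ⊆ finCone I) :
    ∃ K : ℝ, 0 ≤ K ∧ ∀ x ∈ V, ∃ a : (Fin d → ℤ) → ℝ, (∀ v, 0 ≤ a v) ∧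
      (∀ v ∈ I, a v ≤ K * ∑ i, |x i|) ∧ x = ∑ v ∈ I, a v • toReal v := by
  obtain ⟨P, hP⟩ := LinearMap.exists_extend (LinearMap.id : V →ₗ[ℝ] V)
  choose c hc0 hc using fun i : Fin d => hV (P (Pi.single i 1)).2
  choose c' hc0' hc' using fun i : Fin d => hV (-P (Pi.single i 1)).2
  refine ⟨∑ i, ∑ v ∈ I, (c i v + c' i v), Finset.sum_nonneg fun i _ => Finset.sum_nonneg fun v _ =>
    add_nonneg (hc0 i v) (hc0' i v), fun x hx => ?_⟩
  refine ⟨fun v => ∑ i, |x i| * (if 0 ≤ x i then c i v else c' i v), fun v => ?_, fun v hv => ?_, ?_⟩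
  · refine Finset.sum_nonneg fun i _ => mul_nonneg (abs_nonneg _) ?_
    split_ifs
    exacts [hc0 i v, hc0' i v]
  · rw [Finset.mul_sum]
    refine Finset.sum_le_sum fun i _ => ?_
    rw [mul_comm]
    refine mul_le_mul_of_nonneg_right ?_ (abs_nonneg _)
    have h1 : c i v + c' i v ≤ ∑ v ∈ I, (c i v + c' i v) :=
      Finset.single_le_sum (f := fun v => c i v + c' i v)
        (fun v _ => add_nonneg (hc0 i v) (hc0' i v)) hv
    have h2 : ∑ v ∈ I, (c i v + c' i v) ≤ ∑ i, ∑ v ∈ I, (c i v + c' i v) :=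
      Finset.single_le_sum (f := fun i => ∑ v ∈ I, (c i v + c' i v))
        (fun i _ => Finset.sum_nonneg fun v _ => add_nonneg (hc0 i v) (hc0' i v))
        (Finset.mem_univ i)
    have := hc0 i v
    have := hc0' i v
    split_ifs <;> linarith
  · have hPx : P x = ⟨x, hx⟩ := LinearMap.congr_fun hP ⟨x, hx⟩
    have hsum : x = ∑ i, x i • ((P (Pi.single i 1) : V) : Fin d → ℝ) := by
      have h1 : x = ∑ i, x i • (Pi.single i 1 : Fin d → ℝ) := by
        ext j
        simp [Pi.single_apply]
      have h2 := congrArg (fun y => ((P y : V) : Fin d → ℝ)) h1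
      simp only [hPx, map_sum, map_smul] at h2
      simpa using h2
    have hterm : ∀ i, x i • ((P (Pi.single i 1) : V) : Fin d → ℝ) =
        ∑ v ∈ I, (|x i| * (if 0 ≤ x i then c i v else c' i v)) • toReal v := by
      intro i
      by_cases h : 0 ≤ x i
      · simp only [if_pos h, abs_of_nonneg h, mul_smul, ← Finset.smul_sum]
        rw [← hc i]
      · simp only [if_neg h, abs_of_neg (not_le.1 h), mul_smul, ← Finset.smul_sum]
        rw [← hc' i]
        simp
    conv_lhs => rw [hsum, Finset.sum_congr rfl fun i _ => hterm i, Finset.sum_comm]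
    exact Finset.sum_congr rfl fun v _ => by rw [Finset.sum_smul]

theorem span_subset_finCone {I : Finset (Fin d → ℤ)} {S : Set (Fin d → ℝ)}
    (h : ∀ x ∈ S, x ∈ finCone I) (h' : ∀ x ∈ S, -x ∈ finCone I) :
    (Submodule.span ℝ S : Set (Fin d → ℝ)) ⊆ finCone I := by
  intro x hx
  suffices x ∈ finCone I ∧ -x ∈ finCone I from this.1
  induction hx using Submodule.span_induction with
  | mem x hx => exact ⟨h x hx, h' x hx⟩
  | zero => simpa using zero_mem_finCone I
  | add x y _ _ hx hy =>
    rw [neg_add]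
    exact ⟨add_mem_finCone hx.1 hy.1, add_mem_finCone hx.2 hy.2⟩
  | smul c x _ hx =>
    rcases le_total 0 c with hc | hc
    · rw [← smul_neg]
      exact ⟨smul_mem_finCone hx.1 hc, smul_mem_finCone hx.2 hc⟩
    · have hc' : 0 ≤ -c := by linarith
      have h1 := smul_mem_finCone hx.1 hc'
      have h2 := smul_mem_finCone hx.2 hc'
      simp only [neg_smul, smul_neg, neg_neg] at h1 h2
      exact ⟨h2, h1⟩

end LinearAlgebra

end VASS

namespace VASS

section Walks

variable {d : ℕ} {Q : Type}

/-- `A.Walk p l q`: the list of transitions `l` is a possibly empty path from `p` to `q`. -/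
def Walk (A : VASS d Q) : Q → List (Q × (Fin d → ℤ) × Q) → Q → Prop
  | p, [], q => p = q
  | p, t :: l, q => t ∈ A.T ∧ t.1 = p ∧ A.Walk t.2.2 l q

/-- `A.Run p v l`: the transitions in `l` can be fired from the configuration `p v` with all
counters staying positive. -/
def Run (A : VASS d Q) : Q → (Fin d → ℤ) → List (Q × (Fin d → ℤ) × Q) → Prop
  | _, v, [] => ∀ i, 0 < v i
  | p, v, t :: l => (∀ i, 0 < v i) ∧ t ∈ A.T ∧ t.1 = p ∧ A.Run t.2.2 (v + t.2.1) l

/-- The effect of a list of transitions. -/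
def weff (l : List (Q × (Fin d → ℤ) × Q)) : Fin d → ℤ := (l.map fun t => t.2.1).sum

@[simp] theorem weff_nil : weff ([] : List (Q × (Fin d → ℤ) × Q)) = 0 := rfl

@[simp] theorem weff_cons (t : Q × (Fin d → ℤ) × Q) (l : List (Q × (Fin d → ℤ) × Q)) :
    weff (t :: l) = t.2.1 + weff l := by simp [weff]

@[simp] theorem weff_append (l l' : List (Q × (Fin d → ℤ) × Q)) :
    weff (l ++ l') = weff l + weff l' := by simp [weff]

variable {A B : VASS d Q}

theorem walk_append_iff {l l' : List (Q × (Fin d → ℤ) × Q)} {p r : Q} :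
    A.Walk p (l ++ l') r ↔ ∃ q, A.Walk p l q ∧ A.Walk q l' r := by
  induction l generalizing p with
  | nil => simp [Walk]
  | cons t l ih => simp [Walk, ih, and_assoc]

theorem Walk.append {l l' : List (Q × (Fin d → ℤ) × Q)} {p q r : Q} (h : A.Walk p l q)
    (h' : A.Walk q l' r) : A.Walk p (l ++ l') r := walk_append_iff.2 ⟨q, h, h'⟩

theorem Walk.mem {l : List (Q × (Fin d → ℤ) × Q)} {p q : Q} (h : A.Walk p l q) :
    ∀ t ∈ l, t ∈ A.T := by
  induction l generalizing p with
  | nil => simp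
  | cons t l ih =>
    intro s hs
    rcases List.mem_cons.1 hs with rfl | hs
    exacts [h.1, ih h.2.2 s hs]

theorem Walk.of_mem {l : List (Q × (Fin d → ℤ) × Q)} {p q : Q} (h : A.Walk p l q)
    (hB : ∀ t ∈ l, t ∈ B.T) : B.Walk p l q := by
  induction l generalizing p with
  | nil => exact h
  | cons t l ih =>
    exact ⟨hB t (by simp), h.2.1, ih h.2.2 fun s hs => hB s (by simp [hs])⟩

theorem Walk.mono {l : List (Q × (Fin d → ℤ) × Q)} {p q : Q} (h : A.Walk p l q)
    (hB : A.T ⊆ B.T) : B.Walk p l q := h.of_mem fun t ht => hB (h.mem t ht)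

theorem Run.pos {l : List (Q × (Fin d → ℤ) × Q)} {p : Q} {v : Fin d → ℤ} (h : A.Run p v l) :
    ∀ i, 0 < v i := by
  cases l
  exacts [h, h.1]

theorem Run.mono {l : List (Q × (Fin d → ℤ) × Q)} {p : Q} {v : Fin d → ℤ} (h : A.Run p v l)
    (hB : A.T ⊆ B.T) : B.Run p v l := by
  induction l generalizing p v with
  | nil => exact h
  | cons t l ih => exact ⟨h.1, hB h.2.1, h.2.2.1, ih h.2.2.2⟩

theorem Run.of_le {l : List (Q × (Fin d → ℤ) × Q)} {p : Q} {v w : Fin d → ℤ} (h : A.Run p v l)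
    (hw : ∀ i, v i ≤ w i) : A.Run p w l := by
  induction l generalizing p v w with
  | nil => exact fun i => (h i).trans_le (hw i)
  | cons t l ih =>
    exact ⟨fun i => (h.1 i).trans_le (hw i), h.2.1, h.2.2.1,
      ih h.2.2.2 fun i => by simpa using hw i⟩

theorem Run.exists_walk {l : List (Q × (Fin d → ℤ) × Q)} {p : Q} {v : Fin d → ℤ}
    (h : A.Run p v l) : ∃ q, A.Walk p l q := by
  induction l generalizing p v with
  | nil => exact ⟨p, rfl⟩
  | cons t l ih =>
    obtain ⟨q, hq⟩ := ih h.2.2.2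
    exact ⟨q, h.2.1, h.2.2.1, hq⟩

theorem Run.final_pos {l : List (Q × (Fin d → ℤ) × Q)} {p : Q} {v : Fin d → ℤ}
    (h : A.Run p v l) : ∀ i, 0 < (v + weff l) i := by
  induction l generalizing p v with
  | nil => simpa using Run.pos h
  | cons t l ih => simpa [add_assoc] using ih h.2.2.2

theorem Run.append {l l' : List (Q × (Fin d → ℤ) × Q)} {p q : Q} {v : Fin d → ℤ}
    (h : A.Run p v l) (hw : A.Walk p l q) (h' : A.Run q (v + weff l) l') :
    A.Run p v (l ++ l') := by
  induction l generalizing p v with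
  | nil =>
    obtain rfl : p = q := hw
    simpa using h'
  | cons t l ih =>
    refine ⟨h.1, h.2.1, h.2.2.1, ih h.2.2.2 hw.2.2 ?_⟩
    simpa [add_assoc] using h'

theorem abs_upd_le {t : Q × (Fin d → ℤ) × Q} (ht : t ∈ A.T) (i : Fin d) : |t.2.1 i| ≤ 1 := by
  rcases A.upd_mem t ht i with h | h | h <;> simp [h]

theorem Walk.abs_weff_le {l : List (Q × (Fin d → ℤ) × Q)} {p q : Q} (h : A.Walk p l q)
    (i : Fin d) : |weff l i| ≤ l.length := by
  induction l generalizing p with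
  | nil => simp
  | cons t l ih =>
    have h1 := ih h.2.2
    have h2 := abs_upd_le h.1 i
    have h3 := abs_add_le (t.2.1 i) (weff l i)
    simp only [weff_cons, Pi.add_apply, List.length_cons, Nat.cast_add, Nat.cast_one]
    linarith

theorem Walk.run {l : List (Q × (Fin d → ℤ) × Q)} {p q : Q} {v : Fin d → ℤ} (h : A.Walk p l q)
    (hv : ∀ i, (l.length : ℤ) < v i) : A.Run p v l := by
  induction l generalizing p v with
  | nil => simpa [Run] using hv
  | cons t l ih =>
    refine ⟨fun i => lt_of_le_of_lt (by positivity) (hv i), h.1, h.2.1, ih h.2.2 fun i => ?_⟩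
    have h1 := hv i
    have h2 := (abs_le.1 (abs_upd_le h.1 i)).1
    simp only [List.length_cons, Nat.cast_add, Nat.cast_one] at h1
    simp only [Pi.add_apply]
    linarith

/-- The last state of a list of transitions started in `p`. -/
def endp (p : Q) : List (Q × (Fin d → ℤ) × Q) → Q
  | [] => p
  | t :: l => endp t.2.2 l

theorem Walk.endp_eq {l : List (Q × (Fin d → ℤ) × Q)} {p q : Q} (h : A.Walk p l q) :
    endp p l = q := by
  induction l generalizing p with
  | nil => exact h
  | cons t l ih => exact ih h.2.2

/-- A long walk contains a short cycle. -/
theorem Walk.exists_cycle [Fintype Q] {l : List (Q × (Fin d → ℤ) × Q)} {p q : Q}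
    (h : A.Walk p l q) (hl : Nat.card Q ≤ l.length) :
    ∃ l₁ c l₂ r, l = l₁ ++ c ++ l₂ ∧ c ≠ [] ∧ c.length ≤ Nat.card Q ∧
      A.Walk p l₁ r ∧ A.Walk r c r ∧ A.Walk r l₂ q := by
  obtain ⟨i, j, hij, he⟩ := Fintype.exists_ne_map_eq_of_card_lt
    (fun i : Fin (Nat.card Q + 1) => endp p (l.take i)) (by simp)
  wlog hlt : i < j generalizing i j
  · exact this j i hij.symm he.symm (lt_of_le_of_ne (not_lt.1 hlt) hij.symm)
  have hlt' : (i : ℕ) < j := hlt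
  have hj : (j : ℕ) ≤ Nat.card Q := Nat.lt_succ_iff.1 j.2
  have hsplit : l.take j = l.take i ++ (l.take j).drop i := by
    conv_lhs => rw [← List.take_append_drop i (l.take j)]
    rw [List.take_take, min_eq_left hlt'.le]
  have hl' : l = l.take i ++ (l.take j).drop i ++ l.drop j := by
    rw [← hsplit, List.take_append_drop]
  rw [hl'] at h
  obtain ⟨r', h12, h3⟩ := walk_append_iff.1 h
  obtain ⟨r, h1, h2⟩ := walk_append_iff.1 h12
  have hr : r = r' := by
    rw [← h1.endp_eq, ← h12.endp_eq, ← hsplit]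
    exact he
  subst hr
  refine ⟨_, _, _, r, hl', ?_, ?_, h1, h2, h3⟩
  · intro hnil
    have := congrArg List.length hnil
    simp only [List.length_drop, List.length_take, List.length_nil] at this
    omega
  · simp only [List.length_drop, List.length_take]
    omega

theorem walk_of_path {n : ℕ} {p : ℕ → Q} {u : ℕ → Fin d → ℤ}
    (h : ∀ i < n, (p i, u i, p (i + 1)) ∈ A.T) :
    A.Walk (p 0) ((List.range n).map fun i => (p i, u i, p (i + 1))) (p n) := by
  induction n with
  | zero => exact rfl
  | succ n ih =>
    rw [List.range_succ, List.map_append]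
    exact (ih fun i hi => h i (by omega)).append ⟨h n (by omega), rfl, rfl⟩

theorem weff_path (n : ℕ) (p : ℕ → Q) (u : ℕ → Fin d → ℤ) :
    weff ((List.range n).map fun i => (p i, u i, p (i + 1))) = eff n u := by
  induction n with
  | zero =>
    ext
    simp [eff]
  | succ n ih =>
    rw [List.range_succ, List.map_append, weff_append, ih]
    ext
    simp [eff, Finset.sum_range_succ]

theorem Walk.exists_path {l : List (Q × (Fin d → ℤ) × Q)} {p q : Q} (h : A.Walk p l q) :
    ∃ (pp : ℕ → Q) (u : ℕ → Fin d → ℤ), pp 0 = p ∧ pp l.length = q ∧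
      l = (List.range l.length).map fun i => (pp i, u i, pp (i + 1)) := by
  induction l generalizing p with
  | nil => exact ⟨fun _ => p, fun _ => 0, rfl, h, rfl⟩
  | cons t l ih =>
    obtain ⟨pp, u, h0, hn, hl⟩ := ih h.2.2
    refine ⟨fun i => Nat.casesOn i p pp, fun i => Nat.casesOn i t.2.1 u, rfl, hn, ?_⟩
    rw [List.length_cons, List.range_succ_eq_map, List.map_cons, List.map_map]
    congr 1
    obtain ⟨a, b, c⟩ := t
    obtain ⟨-, h1, -⟩ := h
    simp only at h1 h0
    simp [h0, h1]

theorem Walk.path_mem {l : List (Q × (Fin d → ℤ) × Q)} {n : ℕ} {pp : ℕ → Q}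
    {u : ℕ → Fin d → ℤ} (hl : l = (List.range n).map fun i => (pp i, u i, pp (i + 1)))
    (h : ∀ t ∈ l, t ∈ A.T) : ∀ i < n, (pp i, u i, pp (i + 1)) ∈ A.T := by
  intro i hi
  refine h _ ?_
  rw [hl]
  exact List.mem_map.2 ⟨i, List.mem_range.2 hi, rfl⟩

theorem reaches_iff {p q : Q} : A.Reaches p q ↔ ∃ l, l ≠ [] ∧ A.Walk p l q := by
  constructor
  · rintro ⟨n, pp, u, ⟨hn, h⟩, rfl, rfl⟩
    refine ⟨_, ?_, walk_of_path h⟩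
    simp only [ne_eq, List.map_eq_nil_iff, List.range_eq_nil]
    omega
  · rintro ⟨l, hl, h⟩
    obtain ⟨pp, u, h0, hn, hlist⟩ := h.exists_path
    exact ⟨l.length, pp, u, ⟨List.length_pos_iff.2 hl, Walk.path_mem hlist h.mem⟩, h0, hn⟩

/-- Short cycles in terms of lists of transitions. -/
def ShortCycle (A : VASS d Q) (p : Q) (l : List (Q × (Fin d → ℤ) × Q)) : Prop :=
  A.Walk p l p ∧ l ≠ [] ∧ l.length ≤ Nat.card Q

theorem shortCycle_of_isShortCycle {n : ℕ} {p : ℕ → Q} {u : ℕ → Fin d → ℤ}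
    (h : A.IsShortCycle n p u) :
    A.ShortCycle (p 0) ((List.range n).map fun i => (p i, u i, p (i + 1))) := by
  obtain ⟨⟨h1, h2⟩, h3, h4⟩ := h
  refine ⟨?_, ?_, by simpa using h4⟩
  · have := walk_of_path h2
    rwa [h3] at this
  · simp only [ne_eq, List.map_eq_nil_iff, List.range_eq_nil]
    omega

theorem ShortCycle.exists_isShortCycle {p : Q} {l : List (Q × (Fin d → ℤ) × Q)}
    (h : A.ShortCycle p l) : ∃ n pp u, A.IsShortCycle n pp u ∧ eff n u = weff l ∧
      l = (List.range n).map fun i => (pp i, u i, pp (i + 1)) := by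
  obtain ⟨pp, u, h0, hn, hlist⟩ := h.1.exists_path
  refine ⟨l.length, pp, u, ⟨⟨List.length_pos_iff.2 h.2.1, Walk.path_mem hlist h.1.mem⟩,
    by rw [h0, hn], h.2.2⟩, ?_, hlist⟩
  conv_rhs => rw [hlist]
  rw [weff_path]

theorem mem_Inc_iff {v : Fin d → ℤ} : v ∈ A.Inc ↔ ∃ p l, A.ShortCycle p l ∧ v = weff l := by
  constructor
  · rintro ⟨n, p, u, h, rfl⟩
    exact ⟨_, _, shortCycle_of_isShortCycle h, (weff_path _ _ _).symm⟩
  · rintro ⟨p, l, h, rfl⟩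
    obtain ⟨n, pp, u, h1, h2, -⟩ := h.exists_isShortCycle
    exact ⟨n, pp, u, h1, h2.symm⟩

theorem mem_neutral_iff {nv : Fin d → ℝ} {t : Q × (Fin d → ℤ) × Q} :
    t ∈ (A.neutral nv).T ↔ ∃ p l, A.ShortCycle p l ∧ dotZ (weff l) nv = 0 ∧ t ∈ l := by
  constructor
  · rintro ⟨-, n, p, u, h, h0, i, hi, rfl⟩
    refine ⟨_, _, shortCycle_of_isShortCycle h, ?_, ?_⟩
    · rw [weff_path, h0]
    · exact List.mem_map.2 ⟨i, List.mem_range.2 hi, rfl⟩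
  · rintro ⟨p, l, h, h0, ht⟩
    obtain ⟨n, pp, u, h1, h2, h3⟩ := h.exists_isShortCycle
    refine ⟨h.1.mem t ht, n, pp, u, h1, by rw [h2, h0], ?_⟩
    rw [h3] at ht
    obtain ⟨i, hi, rfl⟩ := List.mem_map.1 ht
    exact ⟨i, List.mem_range.1 hi, rfl⟩

theorem neutral_subset (A : VASS d Q) (nv : Fin d → ℝ) : (A.neutral nv).T ⊆ A.T :=
  fun _ h => h.1

/-- `A.Bnd n G`: computations from configurations of size at most `n` have length at most `G`. -/
def Bnd (A : VASS d Q) (n G : ℕ) : Prop :=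
  ∀ (p : Q) (v : Fin d → ℤ) (l : List (Q × (Fin d → ℤ) × Q)),
    (∀ i, v i ≤ n) → A.Run p v l → l.length ≤ G

theorem Bnd.mono {m n G H : ℕ} (h : A.Bnd n G) (hm : m ≤ n) (hG : G ≤ H) : A.Bnd m H :=
  fun p v l hv hl => (h p v l (fun i => (hv i).trans (by exact_mod_cast hm)) hl).trans hG

theorem Bnd.subset {n G : ℕ} (h : A.Bnd n G) (hB : B.T ⊆ A.T) : B.Bnd n G :=
  fun p v l hv hl => h p v l hv (hl.mono hB)

theorem run_of_isZeroAvoiding {n : ℕ} {q : ℕ → Q} {z : ℕ → Fin d → ℕ}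
    (h : A.IsZeroAvoiding n q z) :
    ∃ l, l.length = n ∧ A.Run (q 0) (fun i => (z 0 i : ℤ)) l := by
  induction n generalizing q z with
  | zero => exact ⟨[], rfl, fun i => Nat.cast_pos.2 (h.1 0 le_rfl i)⟩
  | succ n ih =>
    obtain ⟨l, hl, hrun⟩ := ih (q := fun i => q (i + 1)) (z := fun i => z (i + 1))
      ⟨fun i hi => h.1 (i + 1) (by omega), fun i hi => h.2 (i + 1) (by omega)⟩
    refine ⟨(q 0, fun j => (z 1 j : ℤ) - (z 0 j : ℤ), q 1) :: l, by simp [hl],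
      fun i => Nat.cast_pos.2 (h.1 0 (by omega) i), h.2 0 (by omega), rfl, ?_⟩
    convert hrun using 1
    ext i
    simp

theorem Run.exists_isZeroAvoiding {l : List (Q × (Fin d → ℤ) × Q)} {p : Q} {w : Fin d → ℕ}
    (h : A.Run p (fun i => (w i : ℤ)) l) :
    ∃ q z, q 0 = p ∧ z 0 = w ∧ A.IsZeroAvoiding l.length q z := by
  induction l generalizing p w with
  | nil => exact ⟨fun _ => p, fun _ => w, rfl, rfl, fun i _ j => Nat.cast_pos.1 (h j), by simp⟩
  | cons t l ih =>
    have hpos := h.2.2.2.pos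
    have hcast : (fun i => (w i : ℤ)) + t.2.1 = fun i => (((w i + t.2.1 i).toNat : ℕ) : ℤ) := by
      ext i
      have := hpos i
      simp only [Pi.add_apply] at this ⊢
      omega
    have hrun := h.2.2.2
    rw [hcast] at hrun
    obtain ⟨q, z, hq, hz, hzero, hstep⟩ := ih hrun
    refine ⟨fun i => Nat.casesOn i p q, fun i => Nat.casesOn i w z, rfl, rfl, ?_, ?_⟩
    · intro i hi j
      cases i with
      | zero => exact Nat.cast_pos.1 (h.1 j)
      | succ i => exact hzero i (by simpa using hi) j
    · intro i hi
      cases i with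
      | zero =>
        have ht := h.2.1
        have hp := h.2.2.1
        convert ht using 1
        obtain ⟨a, b, c⟩ := t
        simp only at hp hq hz ⊢
        rw [hq, hz, hp]
        congr 2
        ext i
        have := congrFun hcast i
        simp only [Pi.add_apply] at this
        rw [← this]
        exact add_sub_cancel_left (w i : ℤ) (b i)
      | succ i => exact hstep i (by simpa using hi)

theorem L_le_iff (hd : 0 < d) {n G : ℕ} : A.L n ≤ (G : ℕ∞) ↔ A.Bnd n G := by
  simp only [L, Lval, iSup_le_iff, Nat.cast_le]
  constructor
  · intro h p v l hv hl
    have hrun : A.Run p (fun _ => ((n : ℕ) : ℤ)) l := hl.of_le hv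
    obtain ⟨q, z, hq, hz, hza⟩ := Run.exists_isZeroAvoiding (w := fun _ => n) hrun
    have : Nonempty (Fin d) := ⟨⟨0, hd⟩⟩
    exact h p (fun _ => n) (Finset.sup_const Finset.univ_nonempty n) _ ⟨q, z, hq, hz, hza⟩
  · rintro h p v hv m ⟨q, z, rfl, rfl, hza⟩
    obtain ⟨l, rfl, hrun⟩ := run_of_isZeroAvoiding hza
    refine h _ _ l (fun i => ?_) hrun
    exact_mod_cast hv ▸ Finset.le_sup (Finset.mem_univ i)

end Walks

end VASS

namespace VASS

section Potential

variable {d : ℕ} {Q : Type} {A : VASS d Q}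

theorem T_finite [Fintype Q] (A : VASS d Q) : A.T.Finite := by
  refine ((Set.finite_univ (α := Q)).prod
    ((Set.finite_Icc (fun _ : Fin d => (-1 : ℤ)) (fun _ => 1)).prod
      (Set.finite_univ (α := Q)))).subset fun t ht => ?_
  refine ⟨Set.mem_univ _, ?_, Set.mem_univ _⟩
  rw [Set.mem_Icc]
  exact ⟨fun i => (abs_le.1 (abs_upd_le ht i)).1, fun i => (abs_le.1 (abs_upd_le ht i)).2⟩

theorem Inc_finite (A : VASS d Q) : A.Inc.Finite := by
  refine (Set.finite_Icc (fun _ : Fin d => (-(Nat.card Q : ℤ))) (fun _ => (Nat.card Q : ℤ))).subset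
    fun v hv => ?_
  obtain ⟨p, l, hl, rfl⟩ := mem_Inc_iff.1 hv
  have : ∀ i, |weff l i| ≤ (Nat.card Q : ℤ) := fun i =>
    (hl.1.abs_weff_le i).trans (by exact_mod_cast hl.2.2)
  rw [Set.mem_Icc]
  exact ⟨fun i => (abs_le.1 (this i)).1, fun i => (abs_le.1 (this i)).2⟩

theorem exists_potential [Fintype Q] (A : VASS d Q) (w : Q × (Fin d → ℤ) × Q → ℝ)
    (hw : ∀ p l, A.ShortCycle p l → (l.map w).sum ≤ 0) :
    ∃ (h : Q → ℝ) (H : ℝ), (∀ q, 0 ≤ h q) ∧ (∀ q, h q ≤ H) ∧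
      ∀ t ∈ A.T, w t + h t.2.2 ≤ h t.1 := by
  obtain ⟨W₀, hW₀⟩ := (A.T_finite.image w).bddAbove
  set W := max W₀ 0 with hWdef
  have hW0 : 0 ≤ W := le_max_right _ _
  have hW : ∀ t ∈ A.T, w t ≤ W := fun t ht =>
    (hW₀ (Set.mem_image_of_mem w ht)).trans (le_max_left _ _)
  have hlen : ∀ l : List (Q × (Fin d → ℤ) × Q), ∀ p q, A.Walk p l q →
      (l.map w).sum ≤ l.length * W := by
    intro l
    induction l with
    | nil => simp
    | cons t l ih =>
      intro p q h
      have h1 := ih _ _ h.2.2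
      have h2 := hW t h.1
      simp only [List.map_cons, List.sum_cons, List.length_cons, Nat.cast_add, Nat.cast_one]
      linarith
  have hbdd : ∀ n : ℕ, ∀ l : List (Q × (Fin d → ℤ) × Q), l.length = n → ∀ p q, A.Walk p l q →
      (l.map w).sum ≤ Nat.card Q * W := by
    intro n
    induction n using Nat.strong_induction_on with
    | _ n ih =>
      intro l hl p q h
      by_cases hc : Nat.card Q ≤ l.length
      · obtain ⟨l₁, c, l₂, r, rfl, hc0, hcl, h1, h2, h3⟩ := h.exists_cycle hc
        have h4 := hw r c ⟨h2, hc0, hcl⟩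
        have h5 := List.length_pos_iff.2 hc0
        have h6 := ih (l₁ ++ l₂).length (by simp at hl ⊢; omega) _ rfl p q (h1.append h3)
        simp only [List.map_append, List.sum_append] at h6 ⊢
        linarith
      · refine (hlen l p q h).trans (mul_le_mul_of_nonneg_right ?_ hW0)
        exact_mod_cast (not_le.1 hc).le
  set S : Q → Set ℝ := fun p => { x | ∃ l q, A.Walk p l q ∧ x = (l.map w).sum } with hS
  have hSb : ∀ p, BddAbove (S p) := by
    intro p
    refine ⟨Nat.card Q * W, ?_⟩
    rintro x ⟨l, q, h, rfl⟩
    exact hbdd _ l rfl p q h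
  have hS0 : ∀ p, (0 : ℝ) ∈ S p := fun p => ⟨[], p, rfl, rfl⟩
  refine ⟨fun p => sSup (S p), Nat.card Q * W, fun p => le_csSup (hSb p) (hS0 p),
    fun p => csSup_le ⟨0, hS0 p⟩ ?_, fun t ht => ?_⟩
  · rintro x ⟨l, q, h, rfl⟩
    exact hbdd _ l rfl p q h
  · rw [← le_sub_iff_add_le']
    refine csSup_le ⟨0, hS0 _⟩ ?_
    rintro x ⟨l, q, h, rfl⟩
    rw [le_sub_iff_add_le']
    refine le_csSup (hSb t.1) ⟨t :: l, q, ⟨ht, rfl, h⟩, by simp⟩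

theorem Walk.dot_add_le {h : Q → ℝ} {nv : Fin d → ℝ}
    (hh : ∀ t ∈ A.T, dotZ t.2.1 nv + h t.2.2 ≤ h t.1) {p q : Q}
    {l : List (Q × (Fin d → ℤ) × Q)} (hl : A.Walk p l q) : dotZ (weff l) nv + h q ≤ h p := by
  induction l generalizing p with
  | nil =>
    obtain rfl : p = q := hl
    simp [dotZ]
  | cons t l ih =>
    have h1 := ih hl.2.2
    have h2 := hh t hl.1
    have h3 := hl.2.1
    rw [h3] at h2
    rw [weff_cons, dotZ_add]
    linarith

theorem Walk.dot_add_eq {h : Q → ℝ} {nv : Fin d → ℝ}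
    (hh : ∀ t ∈ A.T, dotZ t.2.1 nv + h t.2.2 = h t.1) {p q : Q}
    {l : List (Q × (Fin d → ℤ) × Q)} (hl : A.Walk p l q) : dotZ (weff l) nv + h q = h p := by
  induction l generalizing p with
  | nil =>
    obtain rfl : p = q := hl
    simp [dotZ]
  | cons t l ih =>
    have h1 := ih hl.2.2
    have h2 := hh t hl.1
    have h3 := hl.2.1
    rw [h3] at h2
    rw [weff_cons, dotZ_add]
    linarith

/-- A potential that is constant along neutral transitions and decreases by a fixed amount along
all other transitions. -/
theorem exists_neutral_potential [Fintype Q] (A : VASS d Q) (nv : Fin d → ℝ)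
    (hn : ∀ v ∈ A.Inc, dotZ v nv ≤ 0) :
    ∃ (h : Q → ℝ) (H δ : ℝ), 0 < δ ∧ (∀ q, 0 ≤ h q) ∧ (∀ q, h q ≤ H) ∧
      (∀ t ∈ (A.neutral nv).T, dotZ t.2.1 nv + h t.2.2 = h t.1) ∧
      (∀ t ∈ A.T, t ∉ (A.neutral nv).T → dotZ t.2.1 nv + δ + h t.2.2 ≤ h t.1) := by
  classical
  obtain ⟨ε, hε, hεI⟩ : ∃ ε : ℝ, 0 < ε ∧ ∀ v ∈ A.Inc, dotZ v nv < 0 → dotZ v nv ≤ -ε := by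
    by_cases hne : (A.Inc_finite.toFinset.filter fun v => dotZ v nv < 0).Nonempty
    · obtain ⟨v₀, hv₀, hmax⟩ := Finset.exists_max_image _ (fun v => dotZ v nv) hne
      simp only [Finset.mem_filter, Set.Finite.mem_toFinset] at hv₀ hmax
      exact ⟨-dotZ v₀ nv, by linarith [hv₀.2], fun v hv hlt => by
        linarith [hmax v ⟨hv, hlt⟩]⟩
    · refine ⟨1, one_pos, fun v hv hlt => absurd ⟨v, ?_⟩ hne⟩
      simpa using ⟨hv, hlt⟩
  set N : ℝ := (Nat.card Q : ℝ) + 1 with hN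
  have hN0 : 0 < N := by positivity
  set δ := ε / N with hδ
  have hδ0 : 0 < δ := div_pos hε hN0
  have hδN : δ * N = ε := div_mul_cancel₀ _ hN0.ne'
  have key : ∀ l : List (Q × (Fin d → ℤ) × Q),
      (l.map fun t => dotZ t.2.1 nv + if t ∈ (A.neutral nv).T then 0 else δ).sum
        ≤ dotZ (weff l) nv + δ * l.length := by
    intro l
    induction l with
    | nil => simp [dotZ]
    | cons t l ih =>
      simp only [List.map_cons, List.sum_cons, weff_cons, dotZ_add, List.length_cons,
        Nat.cast_add, Nat.cast_one, mul_add, mul_one]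
      split_ifs <;> linarith
  have key' : ∀ l : List (Q × (Fin d → ℤ) × Q), (∀ t ∈ l, t ∈ (A.neutral nv).T) →
      (l.map fun t => dotZ t.2.1 nv + if t ∈ (A.neutral nv).T then 0 else δ).sum
        = dotZ (weff l) nv := by
    intro l
    induction l with
    | nil => simp [dotZ]
    | cons t l ih =>
      intro hl
      simp only [List.map_cons, List.sum_cons, weff_cons, dotZ_add]
      rw [ih fun s hs => hl s (by simp [hs]), if_pos (hl t (by simp)), add_zero]
  obtain ⟨h, H, h0, hH, hpot⟩ := A.exists_potential
    (fun t => dotZ t.2.1 nv + if t ∈ (A.neutral nv).T then 0 else δ) (by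
      intro p l hl
      have hI : weff l ∈ A.Inc := mem_Inc_iff.2 ⟨p, l, hl, rfl⟩
      rcases (hn _ hI).lt_or_eq with hlt | heq
      · have h1 := hεI _ hI hlt
        have h2 : (l.length : ℝ) ≤ N := by
          have : (l.length : ℝ) ≤ Nat.card Q := by exact_mod_cast hl.2.2
          linarith
        have h3 := mul_le_mul_of_nonneg_left h2 hδ0.le
        linarith [key l]
      · rw [key' l fun t ht => mem_neutral_iff.2 ⟨p, l, hl, heq, ht⟩, heq])
  have hpot' : ∀ t ∈ A.T, dotZ t.2.1 nv + h t.2.2 ≤ h t.1 := by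
    intro t ht
    have := hpot t ht
    split_ifs at this <;> linarith
  refine ⟨h, H, δ, hδ0, h0, hH, fun t ht => ?_, fun t ht hnt => ?_⟩
  · obtain ⟨p, l, hl, hl0, htl⟩ := mem_neutral_iff.1 ht
    refine le_antisymm (hpot' t ht.1) ?_
    obtain ⟨l₁, l₂, rfl⟩ := List.append_of_mem htl
    obtain ⟨q, h1, -, hq, h2⟩ := walk_append_iff.1 hl.1
    have h3 := h1.dot_add_le hpot'
    have h4 := h2.dot_add_le hpot'
    rw [weff_append, weff_cons, dotZ_add, dotZ_add] at hl0
    rw [← hq] at h3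
    linarith
  · have := hpot t ht
    rwa [if_neg hnt] at this

/-- The effect of a closed walk made of neutral transitions. -/
theorem Walk.weff_mem_span [Fintype Q] {nv : Fin d → ℝ} (hn : ∀ v ∈ A.Inc, dotZ v nv ≤ 0) {p : Q}
    {l : List (Q × (Fin d → ℤ) × Q)} (hl : (A.neutral nv).Walk p l p) :
    toReal (weff l) ∈ Submodule.span ℝ (toReal '' { v | v ∈ A.Inc ∧ dotZ v nv = 0 }) := by
  obtain ⟨h, H, δ, -, -, -, heq, -⟩ := A.exists_neutral_potential nv hn
  have hshort : ∀ r c, (A.neutral nv).ShortCycle r c →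
      toReal (weff c) ∈ Submodule.span ℝ (toReal '' { v | v ∈ A.Inc ∧ dotZ v nv = 0 }) := by
    intro r c hc
    refine Submodule.subset_span ⟨weff c, ⟨?_, ?_⟩, rfl⟩
    · exact mem_Inc_iff.2 ⟨r, c, ⟨hc.1.mono (A.neutral_subset nv), hc.2⟩, rfl⟩
    · linarith [hc.1.dot_add_eq heq]
  obtain ⟨n, hln⟩ : ∃ n, l.length = n := ⟨_, rfl⟩
  induction n using Nat.strong_induction_on generalizing l with
  | _ n ih =>
    by_cases hnil : l = []
    · subst hnil
      convert Submodule.zero_mem _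
      ext i
      simp [toReal]
    by_cases hc : l.length ≤ Nat.card Q
    · exact hshort p l ⟨hl, hnil, hc⟩
    · obtain ⟨l₁, c, l₂, r, rfl, hc0, hcl, h1, h2, h3⟩ := hl.exists_cycle (not_le.1 hc).le
      have h5 := List.length_pos_iff.2 hc0
      have h6 := ih (l₁ ++ l₂).length (by simp at hln ⊢; omega) (h1.append h3) rfl
      have h7 := hshort r c ⟨h2, hc0, hcl⟩
      have h8 := Submodule.add_mem _ h6 h7
      rw [← toReal_add] at h8
      convert h8 using 2
      simp only [weff_append]
      abel

/-- The computations of `A` are bounded in terms of the computations of its neutral part. -/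
theorem exists_bnd_of_neutral [Fintype Q] (A : VASS d Q) (nv : Fin d → ℝ)
    (hn : ∀ v ∈ A.Inc, dotZ v nv ≤ 0) (hpos : ∀ i, 0 < nv i) :
    ∃ s c : ℕ, ∀ n G : ℕ, (A.neutral nv).Bnd (s * (n + 1)) G →
      A.Bnd n (c * (n + 1) * (G + 1)) := by
  obtain ⟨h, H, δ, hδ, h0, hH, heq, hlt⟩ := A.exists_neutral_potential nv hn
  have hH0 : 0 ≤ max H 0 := le_max_right _ _
  have hH' : ∀ q, h q ≤ max H 0 := fun q => (hH q).trans (le_max_left _ _)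
  set K : ℝ := ∑ i, nv i + max H 0 with hK
  have hK0 : 0 ≤ K := add_nonneg (Finset.sum_nonneg fun i _ => (hpos i).le) hH0
  have hkey : ∀ n : ℕ, ∀ v : Fin d → ℤ, (∀ i, v i ≤ n) → ∀ p,
      dotZ v nv + h p ≤ K * (n + 1) := by
    intro n v hv p
    have h1 : dotZ v nv ≤ ∑ i, n * nv i := Finset.sum_le_sum fun i _ =>
      mul_le_mul_of_nonneg_right (by exact_mod_cast hv i) (hpos i).le
    rw [← Finset.mul_sum] at h1
    have h2 : 0 ≤ ∑ i, nv i := Finset.sum_nonneg fun i _ => (hpos i).le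
    have h3 : 0 ≤ (n : ℝ) * max H 0 := by positivity
    rw [hK]
    linarith [hH' p]
  have hdot : ∀ v : Fin d → ℤ, (∀ i, 0 < v i) → 0 ≤ dotZ v nv := fun v hv =>
    Finset.sum_nonneg fun i _ => mul_nonneg (by exact_mod_cast (hv i).le) (hpos i).le
  set s : ℕ := ⌈∑ i, K / nv i⌉₊ with hs
  set c : ℕ := ⌈K / δ⌉₊ with hc
  refine ⟨s, c + 1, fun n G hG p v l hv hl => ?_⟩
  have hGN : ∀ p v l, dotZ v nv + h p ≤ K * (n + 1) → (A.neutral nv).Run p v l →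
      l.length ≤ G := by
    intro p v l hΦ hrun
    refine hG p v l (fun i => ?_) hrun
    have h1 : (v i : ℝ) * nv i ≤ dotZ v nv :=
      Finset.single_le_sum (f := fun i => (v i : ℝ) * nv i)
        (fun i _ => mul_nonneg (by exact_mod_cast (hrun.pos i).le) (hpos i).le)
        (Finset.mem_univ i)
    have h2 : (v i : ℝ) ≤ K / nv i * (n + 1) := by
      rw [div_mul_eq_mul_div, le_div_iff₀ (hpos i)]
      linarith [h0 p]
    have h3 : K / nv i ≤ ∑ i, K / nv i :=
      Finset.single_le_sum (f := fun i => K / nv i)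
        (fun i _ => div_nonneg hK0 (hpos i).le) (Finset.mem_univ i)
    have h4 : K / nv i ≤ s := h3.trans (Nat.le_ceil _)
    have h5 : (v i : ℝ) ≤ s * (n + 1) :=
      h2.trans (mul_le_mul_of_nonneg_right h4 (by positivity))
    exact_mod_cast h5
  have main : ∀ l : List (Q × (Fin d → ℤ) × Q), ∀ p v, A.Run p v l →
      dotZ v nv + h p ≤ K * (n + 1) →
      ∃ (l₁ : List (Q × (Fin d → ℤ) × Q)) (k : ℕ), (A.neutral nv).Run p v l₁ ∧
        l.length ≤ l₁.length + k * (1 + G) ∧ k * δ ≤ dotZ v nv + h p := by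
    intro l
    induction l with
    | nil =>
      intro p v hrun hΦ
      exact ⟨[], 0, hrun, by simp, by simpa using add_nonneg (hdot v hrun) (h0 p)⟩
    | cons t l ih =>
      intro p v hrun hΦ
      have ht := hrun.2.2.1
      by_cases hN : t ∈ (A.neutral nv).T
      · have h1 := heq t hN
        rw [ht] at h1
        obtain ⟨l₁, k, hr, hlen, hk⟩ := ih t.2.2 (v + t.2.1) hrun.2.2.2
          (by rw [dotZ_add]; linarith)
        refine ⟨t :: l₁, k, ⟨hrun.1, hN, ht, hr⟩, by simp; omega, ?_⟩
        rw [dotZ_add] at hk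
        linarith
      · have h1 := hlt t hrun.2.1 hN
        rw [ht] at h1
        have hΦ' : dotZ (v + t.2.1) nv + h t.2.2 ≤ K * (n + 1) := by
          rw [dotZ_add]; linarith
        obtain ⟨l₁, k, hr, hlen, hk⟩ := ih t.2.2 (v + t.2.1) hrun.2.2.2 hΦ'
        have h2 := hGN _ _ _ hΦ' hr
        refine ⟨[], k + 1, hrun.1, ?_, ?_⟩
        · simp only [List.length_cons, List.length_nil, add_mul, one_mul]
          omega
        · rw [dotZ_add] at hk
          push_cast
          linarith
  have hΦ := hkey n v hv p
  obtain ⟨l₁, k, hr, hlen, hk⟩ := main l p v hl hΦ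
  have h1 := hGN _ _ _ hΦ hr
  have h2 : (k : ℝ) ≤ c * (n + 1) := by
    have h3 : (k : ℝ) ≤ K / δ * (n + 1) := by
      rw [div_mul_eq_mul_div, le_div_iff₀ hδ]
      linarith
    exact h3.trans (mul_le_mul_of_nonneg_right (Nat.le_ceil _) (by positivity))
  have h3 : k ≤ c * (n + 1) := by exact_mod_cast h2
  calc l.length ≤ G + k * (1 + G) := by omega
    _ ≤ G + c * (n + 1) * (1 + G) := by gcongr
    _ ≤ (c + 1) * (n + 1) * (G + 1) := by nlinarith [Nat.zero_le (n * G)]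

end Potential

end VASS

namespace VASS

section Return

variable {d : ℕ} {Q : Type} {A : VASS d Q}

/-- Strong connectivity as seen by transitions: from the target of any transition one can reach the
source of any other. -/
def TransConnected (A : VASS d Q) : Prop :=
  ∀ t ∈ A.T, ∀ t' ∈ A.T, ∃ l, A.Walk t.2.2 l t'.1

/-- A positive normal such that neutral effects of short cycles are reversible in the cone of all
effects of short cycles. -/
def ReversibleNormal (A : VASS d Q) (nv : Fin d → ℝ) : Prop :=
  (∀ v ∈ A.Inc, dotZ v nv ≤ 0) ∧ (∀ i, 0 < nv i) ∧
    ∀ v ∈ A.Inc, dotZ v nv = 0 → -toReal v ∈ finCone A.Inc_finite.toFinset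

theorem TransConnected.exists_walk (h : A.TransConnected) {t t' : Q × (Fin d → ℤ) × Q}
    (ht : t ∈ A.T) (ht' : t' ∈ A.T) : ∃ l, A.Walk t.1 l t'.1 := by
  obtain ⟨l, hl⟩ := h t ht t' ht'
  exact ⟨t :: l, ht, rfl, hl⟩

theorem exists_walk_length_le [Fintype Q] (A : VASS d Q) :
    ∃ D : ℕ, ∀ p q, (∃ l, A.Walk p l q) → ∃ l, A.Walk p l q ∧ l.length ≤ D := by
  classical
  have : ∀ x : Q × Q, ∃ D : ℕ, (∃ l, A.Walk x.1 l x.2) → ∃ l, A.Walk x.1 l x.2 ∧ l.length ≤ D := by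
    intro x
    by_cases h : ∃ l, A.Walk x.1 l x.2
    · obtain ⟨l, hl⟩ := h
      exact ⟨l.length, fun _ => ⟨l, hl, le_rfl⟩⟩
    · exact ⟨0, fun h' => absurd h' h⟩
  choose D hD using this
  refine ⟨Finset.univ.sup D, fun p q h => ?_⟩
  obtain ⟨l, hl, hle⟩ := hD (p, q) h
  exact ⟨l, hl, hle.trans (Finset.le_sup (Finset.mem_univ (p, q)))⟩

theorem Walk.replicate {p : Q} {l : List (Q × (Fin d → ℤ) × Q)} (h : A.Walk p l p) (k : ℕ) :
    A.Walk p (List.replicate k l).flatten p := by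
  induction k with
  | zero => exact rfl
  | succ k ih => exact h.append ih

theorem weff_replicate (k : ℕ) (l : List (Q × (Fin d → ℤ) × Q)) :
    weff (List.replicate k l).flatten = k • weff l := by
  induction k with
  | zero => simp
  | succ k ih => rw [List.replicate_succ, List.flatten_cons, weff_append, ih, succ_nsmul']

theorem run_replicate {p : Q} {l : List (Q × (Fin d → ℤ) × Q)} {b E : ℕ} (h : A.Walk p l p)
    (hE : ∀ i, -(E : ℤ) ≤ weff l i) (hrun : ∀ u : Fin d → ℤ, (∀ i, (b : ℤ) < u i) → A.Run p u l)
    (k : ℕ) {u : Fin d → ℤ} (hu : ∀ i, (b : ℤ) + E * k < u i) :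
    A.Run p u (List.replicate k l).flatten := by
  induction k generalizing u with
  | zero => exact fun i => lt_of_le_of_lt (by positivity) (hu i)
  | succ k ih =>
    rw [List.replicate_succ, List.flatten_cons]
    refine Run.append (hrun u fun i => lt_of_le_of_lt ?_ (hu i)) h (ih fun i => ?_)
    · exact le_add_of_nonneg_right (by positivity)
    · have h1 := hu i
      have h2 := hE i
      push_cast at h1
      rw [Pi.add_apply]
      linarith

theorem TransConnected.exists_approx [Fintype Q] (hA : A.TransConnected) :
    ∃ D : ℕ, ∀ t ∈ A.T, ∀ a : (Fin d → ℤ) → ℝ, (∀ v, 0 ≤ a v) →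
      ∀ J ⊆ A.Inc_finite.toFinset, ∃ l, A.Walk t.1 l t.1 ∧
        (∀ i, |(weff l i : ℝ) - ∑ v ∈ J, a v * v i| ≤ J.card * D) ∧
        (l.length : ℝ) ≤ ∑ v ∈ J, D * (a v + 1) := by
  classical
  obtain ⟨D, hD⟩ := A.exists_walk_length_le
  refine ⟨2 * D + Nat.card Q, fun t ht a ha J => ?_⟩
  induction J using Finset.induction_on with
  | empty => exact fun _ => ⟨[], rfl, by simp, by simp⟩
  | insert v J hvJ ih =>
    intro hJ
    obtain ⟨l, hl, hel, hll⟩ := ih fun w hw => hJ (Finset.mem_insert_of_mem hw)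
    have hv : v ∈ A.Inc := by simpa using hJ (Finset.mem_insert_self v J)
    obtain ⟨r, c, hc, rfl⟩ := mem_Inc_iff.1 hv
    obtain ⟨t', ht', rfl⟩ : ∃ t' ∈ A.T, t'.1 = r := by
      obtain ⟨hw, hne, -⟩ := hc
      cases c with
      | nil => exact absurd rfl hne
      | cons s c => exact ⟨s, hw.1, hw.2.1⟩
    obtain ⟨w₁, hw₁, hl₁⟩ := hD _ _ (hA.exists_walk ht ht')
    obtain ⟨w₂, hw₂, hl₂⟩ := hD _ _ (hA.exists_walk ht' ht)
    set k := ⌊a (weff c)⌋₊ with hk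
    have hk1 : (k : ℝ) ≤ a (weff c) := Nat.floor_le (ha _)
    have hk2 : a (weff c) < k + 1 := Nat.lt_floor_add_one _
    refine ⟨l ++ (w₁ ++ ((List.replicate k c).flatten ++ w₂)),
      hl.append (hw₁.append ((hc.1.replicate k).append hw₂)), fun i => ?_, ?_⟩
    · rw [Finset.sum_insert hvJ, Finset.card_insert_of_notMem hvJ]
      rw [weff_append, weff_append, weff_append, weff_replicate]
      simp only [Pi.add_apply, Pi.smul_apply]
      rw [nsmul_eq_mul]
      have h1 : |(weff w₁ i : ℝ)| ≤ D := by
        exact_mod_cast (hw₁.abs_weff_le i).trans (by exact_mod_cast hl₁)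
      have h2 : |(weff w₂ i : ℝ)| ≤ D := by
        exact_mod_cast (hw₂.abs_weff_le i).trans (by exact_mod_cast hl₂)
      have h3 : |(weff c i : ℝ)| ≤ Nat.card Q := by
        exact_mod_cast (hc.1.abs_weff_le i).trans (by exact_mod_cast hc.2.2)
      have h4 : |((k : ℝ) - a (weff c)) * weff c i| ≤ Nat.card Q := by
        rw [abs_mul]
        have : |(k : ℝ) - a (weff c)| ≤ 1 := abs_le.2 ⟨by linarith, by linarith⟩
        nlinarith [abs_nonneg (weff c i : ℝ)]
      have h5 := hel i
      push_cast at h5 ⊢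
      rw [abs_le] at *
      constructor <;> linarith
    · rw [Finset.sum_insert hvJ]
      simp only [List.length_append, List.length_flatten, List.map_replicate, List.sum_replicate]
      have h1 : (w₁.length : ℝ) ≤ D := by exact_mod_cast hl₁
      have h2 : (w₂.length : ℝ) ≤ D := by exact_mod_cast hl₂
      have h3 : (c.length : ℝ) ≤ Nat.card Q := by exact_mod_cast hc.2.2
      have h4 : (k : ℝ) * c.length ≤ a (weff c) * Nat.card Q :=
        mul_le_mul hk1 h3 (by positivity) (ha _)
      have h5 : 0 ≤ 2 * (D : ℝ) * a (weff c) := mul_nonneg (by positivity) (ha _)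
      have h6 : (0 : ℝ) ≤ Nat.card Q := by positivity
      push_cast at hll ⊢
      rw [smul_eq_mul]
      push_cast
      linarith

/-- Neutral closed walks can be undone up to a bounded error. -/
theorem ReversibleNormal.exists_return [Fintype Q] {nv : Fin d → ℝ} (hg : A.ReversibleNormal nv)
    (hA : A.TransConnected) :
    ∃ E K : ℕ, ∀ t ∈ A.T, ∀ l, (A.neutral nv).Walk t.1 l t.1 → ∀ m : ℕ,
      (∀ i, |weff l i| ≤ m) → ∃ l', A.Walk t.1 l' t.1 ∧
        (∀ i, |weff l i + weff l' i| ≤ E) ∧ l'.length ≤ K * (m + 1) := by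
  classical
  obtain ⟨D, hD⟩ := hA.exists_approx
  set I := A.Inc_finite.toFinset with hI
  set V := Submodule.span ℝ (toReal '' { v | v ∈ A.Inc ∧ dotZ v nv = 0 }) with hV
  have hVI : (V : Set (Fin d → ℝ)) ⊆ finCone I := by
    refine span_subset_finCone ?_ ?_
    · rintro _ ⟨v, ⟨hv, -⟩, rfl⟩
      exact toReal_mem_finCone (by simpa [hI] using hv)
    · rintro _ ⟨v, ⟨hv, hv0⟩, rfl⟩
      exact hg.2.2 v hv hv0
  obtain ⟨K, hK0, hK⟩ := exists_bounded_coeff V hVI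
  refine ⟨I.card * D, I.card * D * (⌈K⌉₊ * d + 1), fun t ht l hl m hm => ?_⟩
  have hmem : -toReal (weff l) ∈ V := V.neg_mem (hl.weff_mem_span hg.1)
  obtain ⟨a, ha0, haK, hsum⟩ := hK _ hmem
  obtain ⟨l', hl', he, hlen⟩ := hD t ht a ha0 I subset_rfl
  refine ⟨l', hl', fun i => ?_, ?_⟩
  · have h1 := he i
    have h2 : -(weff l i : ℝ) = ∑ v ∈ I, a v * v i := by
      have := congrFun hsum i
      simpa [toReal] using this
    rw [← h2, sub_neg_eq_add, add_comm] at h1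
    exact_mod_cast h1
  · have h1 : ∑ i, |(-toReal (weff l)) i| ≤ d * m := by
      calc ∑ i, |(-toReal (weff l)) i| ≤ ∑ _i : Fin d, (m : ℝ) := Finset.sum_le_sum fun i _ => by
            simp only [Pi.neg_apply, abs_neg, toReal]
            exact_mod_cast hm i
        _ = d * m := by simp
    have h2 : ∀ v ∈ I, D * (a v + 1) ≤ (D : ℝ) * ((⌈K⌉₊ * d + 1) * (m + 1)) := by
      intro v hv
      have h3 : K * ∑ i, |(-toReal (weff l)) i| ≤ ⌈K⌉₊ * (d * m) :=
        mul_le_mul (Nat.le_ceil K) h1 (Finset.sum_nonneg fun i _ => abs_nonneg _) (by positivity)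
      have h4 := haK v hv
      have h5 : (0 : ℝ) ≤ ⌈K⌉₊ * d := by positivity
      have h6 : (0 : ℝ) ≤ m := by positivity
      refine mul_le_mul_of_nonneg_left ?_ (by positivity)
      linarith
    have h7 := hlen.trans (Finset.sum_le_sum h2)
    rw [Finset.sum_const, nsmul_eq_mul] at h7
    have h8 : (l'.length : ℝ) ≤ ((I.card * D * (⌈K⌉₊ * d + 1) * (m + 1) : ℕ) : ℝ) := by
      push_cast
      linarith
    exact_mod_cast h8

end Return

end VASS

namespace VASS

section LowerBound

variable {d : ℕ} {Q : Type} {A : VASS d Q}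

theorem exists_walk_swap_neutral {nv : Fin d → ℝ} {p q : Q} {l : List (Q × (Fin d → ℤ) × Q)}
    (h : (A.neutral nv).Walk p l q) : ∃ l', (A.neutral nv).Walk q l' p := by
  induction l generalizing p with
  | nil => exact ⟨[], Eq.symm h⟩
  | cons t l ih =>
    obtain ⟨l', hl'⟩ := ih h.2.2
    obtain ⟨r, c, hc, hc0, htc⟩ := mem_neutral_iff.1 h.1
    have hcN : (A.neutral nv).Walk r c r :=
      hc.1.of_mem fun s hs => mem_neutral_iff.2 ⟨r, c, hc, hc0, hs⟩
    obtain ⟨c₁, c₂, rfl⟩ := List.append_of_mem htc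
    obtain ⟨q', h1, -, hq', h2⟩ := walk_append_iff.1 hcN
    have hp : q' = p := hq'.symm.trans h.2.1
    rw [hp] at h1
    exact ⟨l' ++ (c₂ ++ c₁), hl'.append (h2.append h1)⟩

theorem ReversibleNormal.exists_mul_length_le [Fintype Q] {nv : Fin d → ℝ}
    (hg : A.ReversibleNormal nv) (hA : A.TransConnected) :
    ∃ s : ℕ, ∀ m G : ℕ, 1 ≤ m → A.Bnd (s * m) G → ∀ p v l, (∀ i, v i ≤ (m : ℤ)) →
      (A.neutral nv).Run p v l → m * l.length ≤ G := by
  obtain ⟨h, H, δ, hδ, h0, hH, heq, -⟩ := A.exists_neutral_potential nv hg.1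
  obtain ⟨E, K, hret⟩ := hg.exists_return hA
  obtain ⟨D, hD⟩ := (A.neutral nv).exists_walk_length_le
  have hpos := hg.2.1
  set S : ℕ := ⌈∑ i, (∑ j, nv j + max H 0) / nv i⌉₊ with hS
  set b : ℕ := D + K * (S + D + 2) + 1 with hb
  refine ⟨b + E + 1, fun m G hm hG p v l hv hl => ?_⟩
  obtain rfl | ⟨t, l₀, rfl⟩ : l = [] ∨ ∃ t l₀, l = t :: l₀ := by
    cases l <;> simp
  · simp
  set l := t :: l₀ with hldef
  have htp : t.1 = p := hl.2.2.1
  have htA : t ∈ A.T := A.neutral_subset nv hl.2.1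
  obtain ⟨q, hw⟩ := hl.exists_walk
  obtain ⟨σ, hσ, hσD⟩ := hD _ _ (exists_walk_swap_neutral hw)
  have hm1 : (1 : ℝ) ≤ m := by exact_mod_cast hm
  have hend : ∀ i, (v + weff l) i ≤ S * m := by
    intro i
    have h1 := hw.dot_add_eq heq
    have h2 : dotZ v nv ≤ ∑ i, m * nv i := Finset.sum_le_sum fun i _ =>
      mul_le_mul_of_nonneg_right (by exact_mod_cast hv i) (hpos i).le
    rw [← Finset.mul_sum] at h2
    have h3 : h p ≤ m * max H 0 :=
      (hH p).trans ((le_max_left _ _).trans (le_mul_of_one_le_left (le_max_right _ _) hm1))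
    have h4 : ((v + weff l) i : ℝ) * nv i ≤ dotZ (v + weff l) nv :=
      Finset.single_le_sum (f := fun i => ((v + weff l) i : ℝ) * nv i)
        (fun i _ => mul_nonneg (by exact_mod_cast (hl.final_pos i).le) (hpos i).le)
        (Finset.mem_univ i)
    rw [dotZ_add] at h4
    have h5 : ((v + weff l) i : ℝ) ≤ (∑ j, nv j + max H 0) / nv i * m := by
      rw [div_mul_eq_mul_div, le_div_iff₀ (hpos i)]
      linarith [h0 q]
    have hT0 : 0 ≤ ∑ j, nv j + max H 0 :=
      add_nonneg (Finset.sum_nonneg fun i _ => (hpos i).le) (le_max_right _ _)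
    have h6 : (∑ j, nv j + max H 0) / nv i ≤ S :=
      (Finset.single_le_sum (f := fun i => (∑ j, nv j + max H 0) / nv i)
        (fun i _ => div_nonneg hT0 (hpos i).le) (Finset.mem_univ i)).trans (Nat.le_ceil _)
    have h7 := h5.trans (mul_le_mul_of_nonneg_right h6 (by positivity))
    exact_mod_cast h7
  have hpσ := hw.append hσ
  have habs : ∀ i, |weff (l ++ σ) i| ≤ (((S + D + 1) * m : ℕ) : ℤ) := by
    intro i
    have h1 := hend i
    have h2 := hl.final_pos i
    have h3 := abs_le.1 (hσ.abs_weff_le i)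
    have h4 : (σ.length : ℤ) ≤ D * m := by
      have : σ.length ≤ D * m := hσD.trans (Nat.le_mul_of_pos_right D hm)
      exact_mod_cast this
    have h5 := hv i
    have h6 := hl.pos i
    have h7 : (0 : ℤ) ≤ S * m := by positivity
    rw [weff_append]
    simp only [Pi.add_apply] at h1 h2 ⊢
    push_cast
    rw [abs_le]
    constructor <;> linarith
  rw [← htp] at hpσ
  obtain ⟨l', hl', hE, hlen⟩ := hret t htA _ hpσ _ habs
  rw [htp] at hpσ hl'
  have hround := (hpσ.mono (A.neutral_subset nv)).append hl'
  have hlen' : (σ ++ l').length ≤ (D + K * (S + D + 2)) * m := by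
    rw [List.length_append]
    calc σ.length + l'.length ≤ D * m + K * ((S + D + 1) * m + m) :=
          add_le_add (hσD.trans (Nat.le_mul_of_pos_right D hm))
            (hlen.trans (Nat.mul_le_mul_left K (by omega)))
      _ = (D + K * (S + D + 2)) * m := by ring
  have hE' : ∀ i, -(E : ℤ) ≤ weff (l ++ σ ++ l') i := fun i => by
    rw [weff_append]
    exact (abs_le.1 (hE i)).1
  have hrun : ∀ u : Fin d → ℤ, (∀ i, ((b * m : ℕ) : ℤ) < u i) → A.Run p u (l ++ σ ++ l') := by
    intro u hu
    have h1 : ∀ i, v i + (σ ++ l').length < u i := by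
      intro i
      have h2 : ((σ ++ l').length : ℤ) ≤ (D + K * (S + D + 2)) * m := by exact_mod_cast hlen'
      have h3 := hu i
      have h4 := hv i
      rw [hb] at h3
      push_cast at h3
      linarith
    rw [List.append_assoc]
    refine Run.append ((hl.mono (A.neutral_subset nv)).of_le fun i => ?_)
      (hw.mono (A.neutral_subset nv))
      (Walk.run ((hσ.mono (A.neutral_subset nv)).append hl') fun i => ?_)
    · have := h1 i
      linarith
    · have h2 := h1 i
      have h3 := hl.final_pos i
      rw [Pi.add_apply] at h3 ⊢
      linarith
  have hfin := run_replicate hround hE' hrun m (u := fun _ => (((b + E + 1) * m : ℕ) : ℤ))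
    fun i => by
      have : b * m + E * m < (b + E + 1) * m := by nlinarith
      exact_mod_cast this
  have := hG _ _ _ (fun i => le_rfl) hfin
  simp only [List.length_flatten, List.map_replicate, List.sum_replicate, smul_eq_mul,
    List.length_append] at this
  refine le_trans (Nat.mul_le_mul_left m ?_) this
  omega

/-- In a terminating transition-connected VASS with at least one transition, some transition is
not neutral. -/
theorem ReversibleNormal.neutral_ne [Fintype Q] {nv : Fin d → ℝ}
    (hg : A.ReversibleNormal nv) (hA : A.TransConnected) (hne : A.T.Nonempty)
    (hterm : ∀ n, ∃ G, A.Bnd n G) : (A.neutral nv).T ≠ A.T := by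
  intro hEq
  obtain ⟨t, ht⟩ := hne
  obtain ⟨E, K, hret⟩ := hg.exists_return hA
  obtain ⟨c, hc⟩ := hA t ht t ht
  have hc' : A.Walk t.1 (t :: c) t.1 := ⟨ht, rfl, hc⟩
  set M : ℕ := (t :: c).length + K * (E + (t :: c).length + 1) with hM
  set u : Fin d → ℤ := fun _ => ((E + M + 1 : ℕ) : ℤ) with hu
  have key : ∀ k : ℕ, ∃ l, A.Walk t.1 l t.1 ∧ A.Run t.1 u l ∧ k ≤ l.length ∧
      ∀ i, |weff l i| ≤ E := by
    intro k
    induction k with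
    | zero =>
      refine ⟨[], rfl, fun i => ?_, le_rfl, by simp⟩
      simp only [hu]
      positivity
    | succ k ih =>
      obtain ⟨l, hl, hrun, hk, hE⟩ := ih
      have hlc := hl.append hc'
      obtain ⟨l', hl', hE', hlen⟩ := hret t ht (l ++ t :: c) (hlc.mono hEq.symm.subset)
        (E + (t :: c).length) fun i => by
          have h1 := hE i
          have h2 := hc'.abs_weff_le i
          rw [weff_append, Pi.add_apply]
          push_cast
          exact (abs_add_le _ _).trans (add_le_add h1 (by exact_mod_cast h2))
      refine ⟨l ++ (t :: c ++ l'), hl.append (hc'.append hl'),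
        hrun.append hl ((hc'.append hl').run fun i => ?_), ?_, fun i => ?_⟩
      · have h1 : (t :: c ++ l').length ≤ M := by
          rw [List.length_append]
          omega
        have h2 := (abs_le.1 (hE i)).1
        have h3 : ((t :: c ++ l').length : ℤ) ≤ M := by exact_mod_cast h1
        simp only [Pi.add_apply, hu]
        push_cast
        linarith
      · simp only [List.length_append, List.length_cons]
        omega
      · rw [← List.append_assoc, weff_append]
        exact hE' i
  obtain ⟨G, hG⟩ := hterm (E + M + 1)
  obtain ⟨l, -, hrun, hk, -⟩ := key (G + 1)
  have := hG _ _ _ (fun i => le_rfl) hrun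
  omega

theorem TransConnected.exists_walk_length_eq (hA : A.TransConnected) (k : ℕ)
    {t : Q × (Fin d → ℤ) × Q} (ht : t ∈ A.T) : ∃ l q, A.Walk t.1 l q ∧ l.length = k := by
  induction k generalizing t with
  | zero => exact ⟨[], t.1, rfl, rfl⟩
  | succ k ih =>
    obtain ⟨t', ht', hs⟩ : ∃ t' ∈ A.T, t'.1 = t.2.2 := by
      obtain ⟨l, hl⟩ := hA t ht t ht
      cases l with
      | nil => exact ⟨t, ht, Eq.symm hl⟩
      | cons s l => exact ⟨s, hl.1, hl.2.1⟩
    obtain ⟨l, q, hl, hk⟩ := ih ht'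
    rw [hs] at hl
    exact ⟨t :: l, q, ⟨ht, rfl, hl⟩, by simp [hk]⟩

theorem TransConnected.le_of_bnd (hA : A.TransConnected) (hne : A.T.Nonempty) {n G : ℕ}
    (h : A.Bnd n G) : n ≤ G + 1 := by
  obtain ⟨t, ht⟩ := hne
  rcases Nat.eq_zero_or_pos n with rfl | hn
  · simp
  obtain ⟨l, q, hl, hlen⟩ := hA.exists_walk_length_eq (n - 1) ht
  have := h t.1 (fun _ => (n : ℤ)) l (fun _ => le_rfl) (hl.run fun i => by
    have : l.length < n := by omega
    exact_mod_cast this)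
  omega

open Filter Topology in
theorem exists_reversibleNormal {n₀ : Fin d → ℝ} (hn : ∀ v ∈ A.Inc, dotZ v n₀ ≤ 0)
    (hpos : ∀ i, 0 < n₀ i) : ∃ nv, A.ReversibleNormal nv := by
  set I := A.Inc_finite.toFinset with hI
  have hmI : ∀ v, v ∈ I ↔ v ∈ A.Inc := fun v => by simp [hI]
  have hsep : ∀ v : Fin d → ℤ, ∃ m : Fin d → ℝ, (∀ w ∈ I, dotZ w m ≤ 0) ∧
      (-toReal v ∉ finCone I → dotZ v m < 0) := by
    intro v
    by_cases h : -toReal v ∈ finCone I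
    · exact ⟨0, by simp [dotZ], fun h' => absurd h h'⟩
    · obtain ⟨m, hm, hlt⟩ := exists_separating h
      rw [dotR_neg_left, dotR_toReal] at hlt
      exact ⟨m, hm, fun _ => by linarith⟩
  choose m hm hlt using hsep
  set M : Fin d → ℝ := ∑ v ∈ I, m v with hM
  have hdM : ∀ w, dotZ w M = ∑ v ∈ I, dotZ w (m v) := fun w => by
    rw [hM, ← dotR_toReal, dotR_sum_right]
    rfl
  have hM1 : ∀ w ∈ I, dotZ w M ≤ 0 := fun w hw => by
    rw [hdM]
    exact Finset.sum_nonpos fun v _ => hm v w hw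
  have hM2 : ∀ w ∈ I, -toReal w ∉ finCone I → dotZ w M < 0 := fun w hw hw' => by
    rw [hdM]
    exact Finset.sum_neg' (fun v _ => hm v w hw) ⟨w, hw, hlt w hw'⟩
  have hev : ∀ᶠ ε : ℝ in 𝓝[>] 0, ∀ i, 0 < n₀ i + ε * M i := by
    refine eventually_all.2 fun i => ?_
    have : Tendsto (fun ε : ℝ => n₀ i + ε * M i) (𝓝[>] 0) (𝓝 (n₀ i + 0 * M i)) :=
      tendsto_nhdsWithin_of_tendsto_nhds (Continuous.tendsto (by fun_prop) 0)
    rw [zero_mul, add_zero] at this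
    exact this.eventually_const_lt (hpos i)
  obtain ⟨ε, hε, hε0⟩ := (hev.and self_mem_nhdsWithin).exists
  have hε0 : 0 < ε := hε0
  have hdot : ∀ w, dotZ w (n₀ + ε • M) = dotZ w n₀ + ε * dotZ w M := fun w => by
    rw [← dotR_toReal, dotR_add_right, dotR_smul_right]
    rfl
  refine ⟨n₀ + ε • M, fun v hv => ?_, fun i => by simpa using hε i, fun v hv h0 => ?_⟩
  · rw [hdot]
    have := mul_nonneg hε0.le (neg_nonneg.2 (hM1 v ((hmI v).2 hv)))
    linarith [hn v hv]
  · by_contra hcon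
    rw [hdot] at h0
    have := mul_pos hε0 (neg_pos.2 (hM2 v ((hmI v).2 hv) hcon))
    linarith [hn v hv]

end LowerBound

end VASS

namespace VASS

section Doubling

variable {d : ℕ} {Q : Type} {A B : VASS d Q}

theorem Inc_mono (h : B.T ⊆ A.T) : B.Inc ⊆ A.Inc := by
  intro v hv
  obtain ⟨p, l, hl, rfl⟩ := mem_Inc_iff.1 hv
  exact mem_Inc_iff.2 ⟨p, l, ⟨hl.1.mono h, hl.2⟩, rfl⟩

/-- The transitions of `A` lying on a closed walk through `q`. -/
def comp (A : VASS d Q) (q : Q) : VASS d Q where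
  T := { t ∈ A.T | (∃ l, A.Walk q l t.1) ∧ ∃ l, A.Walk t.2.2 l q }
  upd_mem := fun t ht i => A.upd_mem t ht.1 i

theorem comp_subset (A : VASS d Q) (q : Q) : (A.comp q).T ⊆ A.T := fun _ h => h.1

theorem Walk.comp {q a b : Q} {l : List (Q × (Fin d → ℤ) × Q)} (h : A.Walk a l b)
    (ha : ∃ l, A.Walk q l a) (hb : ∃ l, A.Walk b l q) : (A.comp q).Walk a l b := by
  induction l generalizing a with
  | nil => exact h
  | cons t l ih =>
    obtain ⟨l₁, h₁⟩ := ha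
    obtain ⟨l₂, h₂⟩ := hb
    have ht := h.2.1
    rw [← ht] at h₁
    exact ⟨⟨h.1, ⟨l₁, h₁⟩, l ++ l₂, h.2.2.append h₂⟩, ht,
      ih h.2.2 ⟨l₁ ++ [t], h₁.append ⟨h.1, rfl, rfl⟩⟩⟩

theorem comp_transConnected (A : VASS d Q) (q : Q) : (A.comp q).TransConnected := by
  rintro t ⟨ht, ⟨l₁, h₁⟩, l₂, h₂⟩ t' ⟨ht', ⟨l₁', h₁'⟩, l₂', h₂'⟩
  exact ⟨l₂ ++ l₁', (h₂.append h₁').comp ⟨l₁ ++ [t], h₁.append ⟨ht, rfl, rfl⟩⟩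
    ⟨t' :: l₂', ht', rfl, h₂'⟩⟩

theorem Run.of_mem {p : Q} {v : Fin d → ℤ} {l : List (Q × (Fin d → ℤ) × Q)} (h : A.Run p v l)
    (hB : ∀ t ∈ l, t ∈ B.T) : B.Run p v l := by
  induction l generalizing p v with
  | nil => exact h
  | cons t l ih =>
    exact ⟨h.1, hB t (by simp), h.2.2.1, ih h.2.2.2 fun s hs => hB s (by simp [hs])⟩

theorem Run.comp_neutral {nv : Fin d → ℝ} {p : Q} {v : Fin d → ℤ}
    {l : List (Q × (Fin d → ℤ) × Q)} (h : (A.neutral nv).Run p v l) :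
    ((A.neutral nv).comp p).Run p v l := by
  obtain ⟨q, hw⟩ := h.exists_walk
  exact h.of_mem (hw.comp ⟨[], rfl⟩ (exists_walk_swap_neutral hw)).mem

/-- Scaling the initial configuration by a constant factor changes the length of the longest
computations by at most a constant factor. -/
def Doubling (A : VASS d Q) : Prop :=
  ∀ s : ℕ, ∃ c n₀ : ℕ, ∀ n G, n₀ ≤ n → A.Bnd n G → A.Bnd (s * n) (c * G)

theorem doubling_neutral [Fintype Q] {nv : Fin d → ℝ}
    (h : ∀ q, ((A.neutral nv).comp q).Doubling) : (A.neutral nv).Doubling := by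
  intro s
  choose c n₀ hc using fun q => h q s
  refine ⟨Finset.univ.sup c, Finset.univ.sup n₀, fun n G hn hG p v l hv hl => ?_⟩
  have h1 := hc p n G ((Finset.le_sup (Finset.mem_univ p)).trans hn)
    (hG.subset (comp_subset _ p)) p v l hv hl.comp_neutral
  exact h1.trans (Nat.mul_le_mul_right G (Finset.le_sup (Finset.mem_univ p)))

/-- The computations of `A` are longer than those of its neutral part by a linear factor. -/
theorem ReversibleNormal.exists_bnd_iff [Fintype Q] {nv : Fin d → ℝ}
    (hg : A.ReversibleNormal nv) (hA : A.TransConnected) (hN : (A.neutral nv).Doubling) :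
    ∃ C n₀ : ℕ, ∀ n G, n₀ ≤ n →
      ((A.neutral nv).Bnd n G → A.Bnd n (C * n * (G + 1))) ∧
      (A.Bnd n G → ∃ G', (A.neutral nv).Bnd n G' ∧ n * G' ≤ C * G) := by
  obtain ⟨s, c, hsc⟩ := exists_bnd_of_neutral A nv hg.1 hg.2.1
  obtain ⟨s₁, hs₁⟩ := hg.exists_mul_length_le hA
  obtain ⟨c', n₁, hc'⟩ := hN (2 * s)
  obtain ⟨c'', n₂, hc''⟩ := hN (2 * (s₁ + 1))
  refine ⟨2 * c * (c' + 1) + 2 * (s₁ + 1) * c'', n₁ + (s₁ + 1) * (n₂ + 1),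
    fun n G hn => ⟨fun h => ?_, fun h => ?_⟩⟩
  · have hn1 : n₁ ≤ n := by omega
    have hn2 : 1 ≤ n := by nlinarith
    have h1 := hsc n (c' * G) ((hc' n G hn1 h).mono (by nlinarith) le_rfl)
    refine h1.mono le_rfl ?_
    calc c * (n + 1) * (c' * G + 1) ≤ c * (2 * n) * ((c' + 1) * (G + 1)) := by
          gcongr
          · omega
          · nlinarith
      _ = (2 * c * (c' + 1)) * n * (G + 1) := by ring
      _ ≤ _ := by
          gcongr
          exact Nat.le_add_right _ _
  · set m := n / (s₁ + 1) with hm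
    have hm1 : n₂ + 1 ≤ m := by
      rw [hm, Nat.le_div_iff_mul_le (Nat.succ_pos _)]
      nlinarith
    have hm2 : (s₁ + 1) * m ≤ n := Nat.mul_div_le n (s₁ + 1)
    have hm3 : n ≤ 2 * (s₁ + 1) * m := by
      have := Nat.lt_mul_div_succ n (Nat.succ_pos s₁)
      rw [Nat.succ_eq_add_one, ← hm] at this
      nlinarith
    have hNm : (A.neutral nv).Bnd m (G / m) := by
      intro p v l hv hl
      rw [Nat.le_div_iff_mul_le (by omega), mul_comm]
      exact hs₁ m G (by omega) (h.mono (by nlinarith) le_rfl) p v l hv hl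
    refine ⟨c'' * (G / m), (hc'' m _ (by omega) hNm).mono hm3 le_rfl, ?_⟩
    calc n * (c'' * (G / m)) ≤ 2 * (s₁ + 1) * m * (c'' * (G / m)) := Nat.mul_le_mul_right _ hm3
      _ = 2 * (s₁ + 1) * c'' * (m * (G / m)) := by ring
      _ ≤ 2 * (s₁ + 1) * c'' * G := Nat.mul_le_mul_left _ (Nat.mul_div_le G m)
      _ ≤ _ := Nat.mul_le_mul_right G (Nat.le_add_left _ _)

theorem TransConnected.doubling [Fintype Q] (hA : A.TransConnected)
    (hterm : ∀ n, ∃ G, A.Bnd n G) {w : Fin d → ℝ} (hw : ∀ v ∈ A.Inc, dotZ v w ≤ 0)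
    (hpos : ∀ i, 0 < w i) : A.Doubling := by
  obtain ⟨k, hk⟩ : ∃ k, A.T.ncard = k := ⟨_, rfl⟩
  induction k using Nat.strong_induction_on generalizing A with
  | _ k ih =>
    rcases A.T.eq_empty_or_nonempty with hemp | hne
    · refine fun s => ⟨0, 0, fun n G _ _ p v l _ hl => ?_⟩
      cases l with
      | nil => simp
      | cons t l => exact absurd hl.2.1 (by simp [hemp])
    · obtain ⟨nv, hg⟩ := exists_reversibleNormal hw hpos
      have hss : (A.neutral nv).T ⊂ A.T :=
        (A.neutral_subset nv).ssubset_of_ne (hg.neutral_ne hA hne hterm)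
      have hN : (A.neutral nv).Doubling := by
        refine doubling_neutral fun q => ?_
        have hsub : ((A.neutral nv).comp q).T ⊆ A.T := (comp_subset _ q).trans hss.1
        refine ih _ ?_ (comp_transConnected _ q) (fun n => ?_) (fun v hv => hw v (Inc_mono hsub hv))
          rfl
        · rw [← hk]
          exact Set.ncard_lt_ncard ((comp_subset _ q).trans_ssubset hss) A.T_finite
        · obtain ⟨G, hG⟩ := hterm n
          exact ⟨G, hG.subset hsub⟩
      obtain ⟨C, n₁, hC⟩ := hg.exists_bnd_iff hA hN
      intro s
      obtain ⟨c, n₂, hc⟩ := hN s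
      refine ⟨C * s * c * C + 2 * C * s + 1, n₁ + n₂ + 2, fun n G hn hG => ?_⟩
      rcases Nat.eq_zero_or_pos s with rfl | hs
      · exact hG.mono (by simp) (Nat.le_mul_of_pos_left G (by omega))
      obtain ⟨G', hG', hle⟩ := (hC n G (by omega)).2 hG
      have h1 := (hC (s * n) (c * G') ((by omega : n₁ ≤ n).trans (Nat.le_mul_of_pos_left n hs))).1
        (hc n G' (by omega) hG')
      have h2 : n ≤ 2 * G := by
        have := hA.le_of_bnd hne hG
        omega
      refine h1.mono le_rfl ?_
      calc C * (s * n) * (c * G' + 1) = C * s * c * (n * G') + C * s * n := by ring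
        _ ≤ C * s * c * (C * G) + C * s * (2 * G) := by gcongr
        _ ≤ (C * s * c * C + 2 * C * s + 1) * G := by nlinarith

end Doubling

end VASS

namespace VASS

section Restrict

variable {d : ℕ} {Q : Type} {A : VASS d Q}

theorem Run.of_restrict {R : Set Q} {l : List (R × (Fin d → ℤ) × R)} {p : R} {v : Fin d → ℤ}
    (h : (A.restrict R).Run p v l) :
    A.Run p v (l.map fun t => ((t.1 : Q), t.2.1, (t.2.2 : Q))) := by
  induction l generalizing p v with
  | nil => exact h
  | cons t l ih => exact ⟨h.1, h.2.1, congrArg Subtype.val h.2.2.1, ih h.2.2.2⟩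

theorem Bnd.restrict {n G : ℕ} (h : A.Bnd n G) (R : Set Q) : (A.restrict R).Bnd n G :=
  fun p v l hv hl => by simpa using h p v _ hv hl.of_restrict

theorem Run.exists_restrict {R : Set Q} {l : List (Q × (Fin d → ℤ) × Q)} {p : Q}
    {v : Fin d → ℤ} (h : A.Run p v l) (hp : p ∈ R) (hR : ∀ t ∈ l, t.2.2 ∈ R) :
    ∃ l', (A.restrict R).Run ⟨p, hp⟩ v l' ∧ l'.length = l.length := by
  induction l generalizing p v with
  | nil => exact ⟨[], h, rfl⟩
  | cons t l ih =>
    obtain ⟨l', hl', hlen⟩ := ih h.2.2.2 (hR t (by simp)) fun s hs => hR s (by simp [hs])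
    obtain ⟨hv, ht, rfl, -⟩ := h
    exact ⟨(⟨t.1, hp⟩, t.2.1, ⟨t.2.2, hR t (by simp)⟩) :: l', ⟨hv, ht, rfl, hl'⟩, by simp [hlen]⟩

theorem exists_walk_of_reaches {p q : Q} (h : p ≠ q → A.Reaches p q) : ∃ l, A.Walk p l q := by
  by_cases hpq : p = q
  · exact ⟨[], hpq⟩
  · obtain ⟨l, -, hl⟩ := reaches_iff.1 (h hpq)
    exact ⟨l, hl⟩

theorem isSCC_mutually_reachable (A : VASS d Q) (p : Q) :
    A.IsSCC { q | (∃ l, A.Walk p l q) ∧ ∃ l, A.Walk q l p } := by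
  refine ⟨?_, fun S hS hconn => (hS.antisymm fun q hq => ?_).symm⟩
  · rintro q ⟨-, l, hl⟩ r ⟨⟨l', hl'⟩, -⟩ hqr
    refine reaches_iff.2 ⟨l ++ l', fun hnil => hqr ?_, hl.append hl'⟩
    have := hl.append hl'
    rw [hnil] at this
    exact this
  · have hp : p ∈ S := hS ⟨⟨[], rfl⟩, [], rfl⟩
    exact ⟨exists_walk_of_reaches (hconn p hp q hq), exists_walk_of_reaches (hconn q hq p hp)⟩

theorem bnd_of_restrict {n G : ℕ} {nv : Fin d → ℝ}
    (h : ∀ R : Set Q, (A.neutral nv).IsSCC R →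
      (∃ t ∈ (A.neutral nv).T, t.1 ∈ R ∧ t.2.2 ∈ R) → ((A.neutral nv).restrict R).Bnd n G) :
    (A.neutral nv).Bnd n G := by
  intro p v l hv hl
  cases l with
  | nil => simp
  | cons t l =>
    set R : Set Q := { q | (∃ l, (A.neutral nv).Walk p l q) ∧ ∃ l, (A.neutral nv).Walk q l p }
    have hR : ∀ s ∈ t :: l, s.2.2 ∈ R := by
      intro s hs
      obtain ⟨q, hw⟩ := hl.exists_walk
      obtain ⟨hsN, ⟨l₁, h₁⟩, h₂⟩ := (hw.comp ⟨[], rfl⟩ (exists_walk_swap_neutral hw)).mem s hs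
      exact ⟨⟨l₁ ++ [s], h₁.append ⟨hsN, rfl, rfl⟩⟩, h₂⟩
    have hp : p ∈ R := ⟨⟨[], rfl⟩, [], rfl⟩
    obtain ⟨l', hl', hlen⟩ := hl.exists_restrict hp hR
    rw [← hlen]
    refine h R ((A.neutral nv).isSCC_mutually_reachable p)
      ⟨t, hl.2.1, ?_, hR t (by simp)⟩ ⟨p, hp⟩ v l' hv hl'
    rw [hl.2.2.1]
    exact hp

theorem IsGoodNormal.reversibleNormal {nv : Fin d → ℝ} (h : A.IsGoodNormal nv) :
    A.ReversibleNormal nv := by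
  refine ⟨h.1.2, h.2.1, fun v hv hv0 => ?_⟩
  have hI : coneZ A.Inc = finCone A.Inc_finite.toFinset := by
    rw [← coneZ_eq_finCone, Set.Finite.coe_toFinset]
  rw [← hI]
  refine (h.2.2 (toReal v) ?_).2 hv0
  rw [hI]
  exact toReal_mem_finCone (by simpa using hv)

theorem transConnected_of_reaches (h : ∀ p q : Q, p ≠ q → A.Reaches p q) : A.TransConnected :=
  fun t _ t' _ => exists_walk_of_reaches (h t.2.2 t'.1)

end Restrict

end VASS

theorem ENat.toENNReal_le_ofReal_iff {x : ℕ∞} {m : ℕ} (hx : x = m) {y : ℝ} (hy : 0 ≤ y) :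
    (x : ℝ≥0∞) ≤ ENNReal.ofReal y ↔ (m : ℝ) ≤ y := by
  rw [hx, ENat.toENNReal_coe, ← ENNReal.ofReal_natCast, ENNReal.ofReal_le_ofReal_iff hy]

theorem ENat.ofReal_le_toENNReal_iff {x : ℕ∞} {m : ℕ} (hx : x = m) {y : ℝ} :
    ENNReal.ofReal y ≤ (x : ℝ≥0∞) ↔ y ≤ m := by
  rw [hx, ENat.toENNReal_coe, ← ENNReal.ofReal_natCast,
    ENNReal.ofReal_le_ofReal_iff (Nat.cast_nonneg m)]


/-- if `A` is strongly connected with good normal `nv`, and the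
SCCs `C 1, …, C k` of `A^nv` containing a transition all induce terminating
VASS with termination complexity `Θ(f i (n))`, then `A` is terminating with
termination complexity `Θ(n · max_i f i (n))`. -/
theorem stmt13 {d : ℕ} {Q : Type} [Fintype Q] [Nonempty Q] (A : VASS d Q)
    (hsc : ∀ p q : Q, p ≠ q → A.Reaches p q)
    (nv : Fin d → ℝ) (hgood : A.IsGoodNormal nv)
    (k : ℕ) (hk : 1 ≤ k) (C : Fin k → Set Q)
    (hSCC : ∀ i, (A.neutral nv).IsSCC (C i) ∧
        ∃ t ∈ (A.neutral nv).T, t.1 ∈ C i ∧ t.2.2 ∈ C i)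
    (hinj : Function.Injective C)
    (hall : ∀ R : Set Q, (A.neutral nv).IsSCC R →
        (∃ t ∈ (A.neutral nv).T, t.1 ∈ R ∧ t.2.2 ∈ R) → ∃ i, R = C i)
    (f : Fin k → ℕ → ℕ)
    (hterm : ∀ i n, ((A.neutral nv).restrict (C i)).L n ≠ ⊤)
    (hTheta : ∀ i, ∃ a b : ℝ, 0 < a ∧ 0 < b ∧ ∃ N : ℕ, ∀ n : ℕ, N ≤ n →
        ENNReal.ofReal (b * (f i n : ℝ)) ≤ (((A.neutral nv).restrict (C i)).L n : ℝ≥0∞) ∧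
        (((A.neutral nv).restrict (C i)).L n : ℝ≥0∞) ≤ ENNReal.ofReal (a * (f i n : ℝ))) :
    (∀ n, A.L n ≠ ⊤) ∧
    ∃ a b : ℝ, 0 < a ∧ 0 < b ∧ ∃ N : ℕ, ∀ n : ℕ, N ≤ n →
      ENNReal.ofReal (b * ((n : ℝ) * ((Finset.univ.sup (fun i => f i n) : ℕ) : ℝ))) ≤ (A.L n : ℝ≥0∞) ∧
      (A.L n : ℝ≥0∞) ≤ ENNReal.ofReal (a * ((n : ℝ) * ((Finset.univ.sup (fun i => f i n) : ℕ) : ℝ))) := by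
  have hd : 0 < d := by
    rcases Nat.eq_zero_or_pos d with rfl | h
    · exact absurd (Subsingleton.elim nv 0) hgood.1.1
    · exact h
  have hA := VASS.transConnected_of_reaches hsc
  have hg := hgood.reversibleNormal
  have : Nonempty (Fin k) := ⟨⟨0, hk⟩⟩
  choose Lr hLr using fun i n => ENat.ne_top_iff_exists.1 (hterm i n)
  set M : ℕ → ℕ := fun n => Finset.univ.sup fun i => Lr i n with hM
  have hNM : ∀ n, (A.neutral nv).Bnd n (M n) := fun n => VASS.bnd_of_restrict fun R hR ht => by
    obtain ⟨i, rfl⟩ := hall R hR ht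
    rw [← VASS.L_le_iff hd, ← hLr]
    exact_mod_cast Finset.le_sup (f := fun i => Lr i n) (Finset.mem_univ i)
  have hMle : ∀ n G, (A.neutral nv).Bnd n G → M n ≤ G := fun n G h => Finset.sup_le fun i _ => by
    have := (VASS.L_le_iff hd).2 (h.restrict (C i))
    rw [← hLr] at this
    exact_mod_cast this
  have hM1 : ∀ n, 2 ≤ n → 1 ≤ M n := by
    intro n hn
    obtain ⟨t, ht, -⟩ := (hSCC ⟨0, hk⟩).2
    have hw : (A.neutral nv).Walk t.1 [t] t.2.2 := ⟨ht, rfl, rfl⟩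
    have := ((A.neutral nv).comp_transConnected t.1).le_of_bnd
      ⟨t, ht, ⟨[], rfl⟩, VASS.exists_walk_swap_neutral hw⟩
      ((hNM n).subset (VASS.comp_subset _ t.1))
    omega
  have hAfin : ∀ n, A.L n ≠ ⊤ := by
    intro n
    obtain ⟨s, c, h⟩ := VASS.exists_bnd_of_neutral A nv hg.1 hg.2.1
    exact ne_top_of_le_ne_top (ENat.natCast_ne_top _)
      ((VASS.L_le_iff hd).2 (h n _ (hNM (s * (n + 1)))))
  refine ⟨hAfin, ?_⟩
  have hdbl : (A.neutral nv).Doubling := VASS.doubling_neutral fun q =>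
    (VASS.comp_transConnected _ q).doubling
      (fun n => ⟨M n, (hNM n).subset (VASS.comp_subset _ q)⟩)
      (fun v hv => hg.1 v (VASS.Inc_mono
        ((VASS.comp_subset _ q).trans (A.neutral_subset nv)) hv)) hg.2.1
  obtain ⟨K, n₀, hK⟩ := hg.exists_bnd_iff hA hdbl
  choose LA hLA using fun n => ENat.ne_top_iff_exists.1 (hAfin n)
  have hup : ∀ n, n₀ + 2 ≤ n → LA n ≤ 2 * K * (n * M n) := by
    intro n hn
    have h1 := (VASS.L_le_iff hd).2 ((hK n (M n) (by omega)).1 (hNM n))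
    rw [← hLA] at h1
    have h2 : LA n ≤ K * n * (M n + 1) := by exact_mod_cast h1
    calc LA n ≤ K * n * (M n + 1) := h2
      _ ≤ K * n * (2 * M n) := Nat.mul_le_mul_left _ (by have := hM1 n (by omega); omega)
      _ = 2 * K * (n * M n) := by ring
  have hlow : ∀ n, n₀ ≤ n → n * M n ≤ K * LA n := by
    intro n hn
    obtain ⟨G', hG', hle⟩ := (hK n (LA n) hn).2 ((VASS.L_le_iff hd).1 (hLA n).ge)
    exact (Nat.mul_le_mul_left n (hMle n G' hG')).trans hle
  choose a b ha hb N₀ hN₀ using hTheta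
  set α := ∑ i, a i with hα
  set β := ∑ i, (b i)⁻¹ with hβ
  have hα0 : 0 < α := Finset.sum_pos (fun i _ => ha i) Finset.univ_nonempty
  have hβ0 : 0 < β := Finset.sum_pos (fun i _ => inv_pos.2 (hb i)) Finset.univ_nonempty
  have hΘ : ∀ n, Finset.univ.sup N₀ ≤ n →
      (M n : ℝ) ≤ α * (Finset.univ.sup (fun i => f i n) : ℕ) ∧
      ((Finset.univ.sup (fun i => f i n) : ℕ) : ℝ) ≤ β * M n := by
    intro n hn
    have hni : ∀ i, N₀ i ≤ n := fun i => (Finset.le_sup (Finset.mem_univ i)).trans hn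
    constructor
    · obtain ⟨i, -, hi⟩ := Finset.exists_mem_eq_sup Finset.univ Finset.univ_nonempty
        (fun i => Lr i n)
      have h1 := (ENat.toENNReal_le_ofReal_iff (hLr i n).symm
        (mul_nonneg (ha i).le (Nat.cast_nonneg _))).1 (hN₀ i n (hni i)).2
      have h2 : (f i n : ℝ) ≤ (Finset.univ.sup (fun i => f i n) : ℕ) := by
        exact_mod_cast Finset.le_sup (f := fun i => f i n) (Finset.mem_univ i)
      have h3 : a i ≤ α := Finset.single_le_sum (fun j _ => (ha j).le) (Finset.mem_univ i)
      have h4 : (M n : ℝ) = Lr i n := congrArg Nat.cast hi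
      rw [h4]
      exact h1.trans (mul_le_mul h3 h2 (Nat.cast_nonneg _) hα0.le)
    · obtain ⟨i, -, hi⟩ := Finset.exists_mem_eq_sup Finset.univ Finset.univ_nonempty
        (fun i => f i n)
      have h1 := (ENat.ofReal_le_toENNReal_iff (hLr i n).symm).1 (hN₀ i n (hni i)).1
      have h2 : (Lr i n : ℝ) ≤ M n := by
        exact_mod_cast Finset.le_sup (f := fun i => Lr i n) (Finset.mem_univ i)
      have h3 : (b i)⁻¹ ≤ β := Finset.single_le_sum (f := fun j => (b j)⁻¹)
        (fun j _ => (inv_pos.2 (hb j)).le) (Finset.mem_univ i)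
      rw [hi]
      calc (f i n : ℝ) = (b i)⁻¹ * (b i * f i n) := (inv_mul_cancel_left₀ (hb i).ne' _).symm
        _ ≤ β * M n := mul_le_mul h3 (h1.trans h2)
          (mul_nonneg (hb i).le (Nat.cast_nonneg _)) hβ0.le
  have hβK : 0 < β * K + 1 := by positivity
  refine ⟨2 * K * α + 1, (β * K + 1)⁻¹, by positivity, by positivity,
    n₀ + 2 + Finset.univ.sup N₀, fun n hn => ?_⟩
  obtain ⟨h1, h2⟩ := hΘ n (by omega)
  set F : ℝ := ((Finset.univ.sup (fun i => f i n) : ℕ) : ℝ) with hF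
  have hF0 : 0 ≤ F := Nat.cast_nonneg _
  have hn0 : (0 : ℝ) ≤ n := Nat.cast_nonneg _
  constructor
  · rw [ENat.ofReal_le_toENNReal_iff (hLA n).symm, inv_mul_le_iff₀ hβK]
    have h3 : (n : ℝ) * M n ≤ K * LA n := by exact_mod_cast hlow n (by omega)
    calc (n : ℝ) * F ≤ n * (β * M n) := mul_le_mul_of_nonneg_left h2 hn0
      _ = β * (n * M n) := by ring
      _ ≤ β * (K * LA n) := mul_le_mul_of_nonneg_left h3 hβ0.le
      _ ≤ (β * K + 1) * LA n := by
        have : (0 : ℝ) ≤ LA n := Nat.cast_nonneg _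
        linarith
  · rw [ENat.toENNReal_le_ofReal_iff (hLA n).symm (by positivity)]
    have h3 : (LA n : ℝ) ≤ 2 * K * (n * M n) := by exact_mod_cast hup n (by omega)
    calc (LA n : ℝ) ≤ 2 * K * (n * M n) := h3
      _ ≤ 2 * K * (n * (α * F)) := by gcongr
      _ ≤ (2 * K * α + 1) * (n * F) := by
        have : 0 ≤ (n : ℝ) * F := mul_nonneg hn0 hF0
        linarith
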